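/- arXiv:2502.11119 — 5 statements merged into one kernel-verified Lean document; each statement's English description precedes it below -/
import Mathlib

section
/- For every odd prime p, every h ≥ 1, all positive integers t, q_1, …, q_h, and every polynomial f ∈ P_h = 𝔽_p[t_1,…,t_h], the polynomial t_1^{q_1 p^{t+1}} · t_2^{q_2 p^{t+1}} ⋯ t_h^{q_h p^{t+1}} · f^p is hit; consequently, the linear map φ : P_h → P_h given by φ(f) = t_1^{q_1 p^{t+1}} ⋯ t_h^{q_h p^{t+1}} · f^p sends every polynomial into the subspace of hit polynomials, and hence induces the zero linear map between the graded quotients of P_h by the hit polynomials. -/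
open MvPolynomial

/-- The total Steenrod power map `Φ : P_h → P_h[ξ]`, the `𝔽_p`-algebra homomorphism
sending each generator `t_i` to `t_i + t_i^p ξ`. -/
noncomputable def Phi (p h : ℕ) :
    MvPolynomial (Fin h) (ZMod p) →ₐ[ZMod p] Polynomial (MvPolynomial (Fin h) (ZMod p)) :=
  aeval fun i => Polynomial.C (X i) + Polynomial.C (X i ^ p) * Polynomial.X

/-- The Steenrod power operation `𝒫^k : P_h → P_h`: the coefficient of `ξ^k` in `Φ(f)`. -/
noncomputable def steenrodP (p h : ℕ) (k : ℕ) (f : MvPolynomial (Fin h) (ZMod p)) :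
    MvPolynomial (Fin h) (ZMod p) :=
  (Phi p h f).coeff k

/-- The `𝔽_p`-subspace of hit polynomials: the span of `{𝒫^k g : k ≥ 1, g ∈ P_h}`. -/
noncomputable def Hit (p h : ℕ) : Submodule (ZMod p) (MvPolynomial (Fin h) (ZMod p)) :=
  Submodule.span (ZMod p) {g | ∃ k, 1 ≤ k ∧ ∃ u, g = steenrodP p h k u}

/-- `𝒫^d` takes `f` to `f^p`, and `d` bounds the `ξ`-degree of `Φ(f)`. -/
def TopPow (p h d : ℕ) (f : MvPolynomial (Fin h) (ZMod p)) : Prop :=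
  (Phi p h f).natDegree ≤ d ∧ (Phi p h f).coeff d = f ^ p

theorem TopPow.mul {p h d e : ℕ} {f g : MvPolynomial (Fin h) (ZMod p)}
    (hf : TopPow p h d f) (hg : TopPow p h e g) : TopPow p h (d + e) (f * g) := by
  unfold TopPow
  rw [map_mul]
  refine ⟨Polynomial.natDegree_mul_le_of_le hf.1 hg.1, ?_⟩
  rw [Polynomial.coeff_mul_add_eq_of_natDegree_le hf.1 hg.1, hf.2, hg.2, mul_pow]

theorem topPow_X (p h : ℕ) (i : Fin h) : TopPow p h 1 (X i) := by
  unfold TopPow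
  have e : Phi p h (X i) = Polynomial.C (X i) + Polynomial.C (X i ^ p) * Polynomial.X := by
    simp [Phi]
  rw [e]
  constructor
  · rw [add_comm]
    exact Polynomial.natDegree_linear_le
  · rw [Polynomial.coeff_add, Polynomial.coeff_C_mul, Polynomial.coeff_X_one]
    simp [Polynomial.coeff_C]

theorem topPow_C (p h : ℕ) [Fact p.Prime] (a : ZMod p) : TopPow p h 0 (C a) := by
  unfold TopPow
  have e : Phi p h (C a) = Polynomial.C (C a) := by
    simp only [Phi, aeval_C]
    rfl
  rw [e, ← map_pow, ZMod.pow_card]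
  simp

theorem topPow_monomial (p h : ℕ) [Fact p.Prime] (s : Fin h →₀ ℕ) (a : ZMod p) :
    ∃ d, TopPow p h d (monomial s a) := by
  refine induction_on_monomial (motive := fun f => ∃ d, TopPow p h d f) ?_ ?_ s a
  · exact fun a => ⟨0, topPow_C p h a⟩
  · rintro f i ⟨d, hd⟩
    exact ⟨d + 1, hd.mul (topPow_X p h i)⟩

theorem X_mul_pow_hit (p h : ℕ) [Fact p.Prime] (i : Fin h)
    (f : MvPolynomial (Fin h) (ZMod p)) : (X i * f) ^ p ∈ Hit p h := by
  induction f using MvPolynomial.induction_on' with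
  | monomial s a =>
    obtain ⟨d, hd⟩ := topPow_monomial p h s a
    exact Submodule.subset_span ⟨1 + d, by omega, _, ((topPow_X p h i).mul hd).2.symm⟩
  | add f g hf hg =>
    rw [mul_add, add_pow_char]
    exact Submodule.add_mem _ hf hg

/-- For positive integers `t, q₁, …, q_h`, the polynomial
`t₁^{q₁ p^{t+1}} ⋯ t_h^{q_h p^{t+1}} f^p` is hit for every `f ∈ P_h`; consequently, the map
`φ(f) = t₁^{q₁ p^{t+1}} ⋯ t_h^{q_h p^{t+1}} f^p` sends every polynomial into the hit
polynomials, so it induces the zero map on the quotients by hit polynomials. -/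
theorem phi_hit (p : ℕ) (hp : p.Prime) (hodd : Odd p) (h : ℕ) (hh : 1 ≤ h)
    (t : ℕ) (ht : 1 ≤ t) (q : Fin h → ℕ) (hq : ∀ i, 1 ≤ q i)
    (f : MvPolynomial (Fin h) (ZMod p)) :
    (∏ i, X i ^ (q i * p ^ (t + 1))) * f ^ p ∈ Hit p h ∧
      (Submodule.Quotient.mk (p := Hit p h)
          ((∏ i, X i ^ (q i * p ^ (t + 1))) * f ^ p) = 0) := by
  have : Fact p.Prime := ⟨hp⟩
  suffices H : (∏ i, X i ^ (q i * p ^ (t + 1))) * f ^ p ∈ Hit p h from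
    ⟨H, (Submodule.Quotient.mk_eq_zero _).2 H⟩
  have e : (∏ i, (X i : MvPolynomial (Fin h) (ZMod p)) ^ (q i * p ^ (t + 1))) * f ^ p
      = ((∏ i, X i ^ (q i * p ^ t)) * f) ^ p := by
    rw [mul_pow, ← Finset.prod_pow]
    congr 1
    refine Finset.prod_congr rfl fun i _ => ?_
    rw [← pow_mul, pow_succ, mul_assoc]
  let i₀ : Fin h := ⟨0, hh⟩
  have hd : (X i₀ : MvPolynomial (Fin h) (ZMod p)) ∣ (∏ i, X i ^ (q i * p ^ t)) * f := by
    refine Dvd.dvd.mul_right (dvd_trans (dvd_pow_self _ ?_)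
      (Finset.dvd_prod_of_mem (fun i => X i ^ (q i * p ^ t)) (Finset.mem_univ i₀))) f
    exact Nat.mul_ne_zero (by have := hq i₀; omega) (pow_ne_zero _ hp.ne_zero)
  obtain ⟨g, hg⟩ := hd
  rw [e, hg]
  exact X_mul_pow_hit p h i₀ g
end

section
/- One-variable hit problem, non-hit monomials: Let p be an odd prime and let x denote the generator of P_1 = 𝔽_p[x]. If m is a natural number satisfying one of the following conditions: (a) 0 ≤ m ≤ p−2; (b) m = (i+1)p − 1 for some 0 ≤ i ≤ p−1; (c) m = (i+1)p^r − 1 for some 1 ≤ i ≤ p−1 and r ≥ 2; then the monomial x^m is not hit in P_1. -/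
open MvPolynomial

/-- The arithmetic core: `p` divides `C(d,k)` when `d + k(p-1) = (i+1)p^r - 1`. -/
lemma core_dvd (p : ℕ) (hp : p.Prime) (j r d k : ℕ) (hj : j ≤ p) (hk : 1 ≤ k) (hkd : k ≤ d)
    (h : d + 1 + k * p = j * p ^ r + k) : p ∣ d.choose k := by
  obtain ⟨s, k', hk', rfl⟩ := Nat.exists_eq_pow_mul_and_not_dvd (n := k) (by omega) p hp.ne_one
  have hp0 : 0 < p := hp.pos
  have hk'0 : 0 < k' := Nat.pos_of_ne_zero (by rintro rfl; simp at hk')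
  -- the valuation of `k` is less than `r`
  have hsr : s + 1 ≤ r := by
    by_contra hcon
    have h1 : p ^ r ≤ p ^ s := Nat.pow_le_pow_right hp0 (by omega)
    have h2 : p ^ s ≤ p ^ s * k' := Nat.le_mul_of_pos_right _ hk'0
    have h3 : j * p ^ r ≤ p * (p ^ s * k') := Nat.mul_le_mul hj (h1.trans h2)
    have h4 : p * (p ^ s * k') = p ^ s * k' * p := mul_comm _ _
    omega
  obtain ⟨t, rfl⟩ := Nat.exists_eq_add_of_le hsr
  have hd : (p ^ s * k') ≤ d + 1 := by omega
  obtain ⟨e, he⟩ := Nat.exists_eq_add_of_le hd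
  have hpe : p ^ (s + 1) ∣ e := by
    have h5 : e + p ^ (s + 1) * k' = p ^ (s + 1) * (j * p ^ t) := by
      have : e + p ^ s * k' * p = j * p ^ (s + 1 + t) := by omega
      calc e + p ^ (s + 1) * k' = e + p ^ s * k' * p := by ring
        _ = _ := by rw [this]; ring
    exact (Nat.dvd_add_left (Dvd.intro _ rfl)).1 (h5 ▸ Dvd.intro _ rfl)
  obtain ⟨f, rfl⟩ := hpe
  have h6 := Nat.choose_mul_succ_eq d (p ^ s * k')
  have h7 : d + 1 - p ^ s * k' = p ^ (s + 1) * f := by omega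
  rw [h7, he] at h6
  have h8 : p ^ s * (d.choose (p ^ s * k') * (k' + p * f)) =
      p ^ s * (p * ((p ^ s * k' + p ^ (s + 1) * f).choose (p ^ s * k') * f)) := by
    rw [pow_succ] at h6 ⊢
    linarith
  have h9 := Nat.eq_of_mul_eq_mul_left (pow_pos hp0 s) h8
  have h10 : p ∣ d.choose (p ^ s * k') * (k' + p * f) := h9 ▸ Dvd.intro _ rfl
  rcases hp.dvd_mul.1 h10 with h | h
  · exact h
  · exact absurd ((Nat.dvd_add_left (Dvd.intro _ rfl)).1 h) hk'

lemma coeff_lin_pow {R : Type*} [CommRing R] (a b : R) (d k : ℕ) :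
    ((Polynomial.C a + Polynomial.C b * Polynomial.X) ^ d).coeff k =
      b ^ k * a ^ (d - k) * (d.choose k : R) := by
  have h : Polynomial.C a + Polynomial.C b * Polynomial.X =
      (Polynomial.X + Polynomial.C a : Polynomial R).comp (Polynomial.C b * Polynomial.X) := by
    simp [add_comm]
  rw [h, ← Polynomial.pow_comp, Polynomial.comp_C_mul_X_coeff, Polynomial.coeff_X_add_C_pow]
  ring

lemma steenrodP_mono (p d k : ℕ) (c : ZMod p) :
    steenrodP p 1 k (C c * X 0 ^ d) =
      C c * (X 0 ^ (p * k + (d - k)) * C (d.choose k : ZMod p)) := by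
  have hC : Phi p 1 (C c) = Polynomial.C (C c) := by
    simp only [Phi, ← MvPolynomial.algebraMap_eq, AlgHom.commutes]
    rfl
  have hX : Phi p 1 (X 0) = Polynomial.C (X 0) + Polynomial.C (X 0 ^ p) * Polynomial.X := by
    simp [Phi]
  rw [steenrodP, map_mul, map_pow, hC, hX, Polynomial.coeff_C_mul, coeff_lin_pow, ← pow_mul,
    ← pow_add, map_natCast]

/-- One-variable hit problem, non-hit monomials: if `m ≤ p-2`, or `m = (i+1)p - 1` with
`0 ≤ i ≤ p-1`, or `m = (i+1)p^r - 1` with `1 ≤ i ≤ p-1` and `r ≥ 2`, then `x^m` is not hit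
in `P₁ = 𝔽_p[x]`. -/
theorem one_var_not_hit (p : ℕ) (hp : p.Prime) (hodd : Odd p) (m : ℕ)
    (hm : m ≤ p - 2 ∨
      (∃ i, i ≤ p - 1 ∧ m = (i + 1) * p - 1) ∨
      (∃ i r, 1 ≤ i ∧ i ≤ p - 1 ∧ 2 ≤ r ∧ m = (i + 1) * p ^ r - 1)) :
    (X 0 : MvPolynomial (Fin 1) (ZMod p)) ^ m ∉ Hit p 1 := by
  have : Fact p.Prime := ⟨hp⟩
  have hp2 : 2 ≤ p := hp.two_le
  have key : ∀ d k, 1 ≤ k → k ≤ d → p * k + (d - k) = m → p ∣ d.choose k := by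
    intro d k hk hkd h
    have hpk : p ≤ p * k := Nat.le_mul_of_pos_right _ hk
    have main : ∀ i r, i ≤ p - 1 → m = (i + 1) * p ^ r - 1 → p ∣ d.choose k := by
      intro i r hi hmr
      have hpos : 0 < (i + 1) * p ^ r := by positivity
      refine core_dvd p hp (i + 1) r d k (by omega) hk hkd ?_
      rw [mul_comm k p]
      omega
    rcases hm with hm | ⟨i, hi, hm⟩ | ⟨i, r, -, hi, -, hm⟩
    · omega
    · exact main i 1 hi (by simpa using hm)
    · exact main i r hi hm
  have hle : Hit p 1 ≤ LinearMap.ker (MvPolynomial.lcoeff (R := ZMod p) (Finsupp.single (0 : Fin 1) m)) := by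
    rw [Hit, Submodule.span_le]
    rintro _ ⟨k, hk, u, rfl⟩
    simp only [SetLike.mem_coe, LinearMap.mem_ker, MvPolynomial.lcoeff_apply]
    induction u using MvPolynomial.induction_on' with
    | monomial a c =>
      have ha : monomial a c = C c * (X 0 : MvPolynomial (Fin 1) (ZMod p)) ^ (a 0) := by
        rw [MvPolynomial.monomial_eq, Finsupp.prod_fintype _ _ (by simp)]
        simp
      rw [ha, steenrodP_mono, coeff_C_mul, mul_comm (X 0 ^ _), coeff_C_mul, coeff_X_pow]
      split_ifs with h
      · have h' := Finsupp.single_injective (0 : Fin 1) h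
        by_cases hkd : k ≤ a 0
        · rw [(ZMod.natCast_eq_zero_iff _ _).2 (key _ _ hk hkd h')]
          simp
        · rw [Nat.choose_eq_zero_of_lt (by omega)]
          simp
      · simp
    | add u v hu hv =>
      have : steenrodP p 1 k (u + v) = steenrodP p 1 k u + steenrodP p 1 k v := by
        simp [steenrodP]
      rw [this, coeff_add, hu, hv, add_zero]
  intro hmem
  have := hle hmem
  simp [coeff_X_pow] at this
end

section
/- One-variable hit problem, hit monomials: Let p be an odd prime and let x denote the generator of P_1 = 𝔽_p[x]. If m is a natural number satisfying none of the following conditions: (a) 0 ≤ m ≤ p−2; (b) m = (i+1)p − 1 for some 0 ≤ i ≤ p−1; (c) m = (i+1)p^r − 1 for some 1 ≤ i ≤ p−1 and r ≥ 2; then the monomial x^m is hit in P_1. Consequently, in every such degree m the quotient of the degree-m homogeneous component of P_1 by the hit polynomials is the zero vector space. -/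
open MvPolynomial

theorem choose_aux (p : ℕ) (hp : p.Prime) (a s : ℕ) :
    (p ^ s * (a + 1) - 1).choose (p ^ s) ≡ a [MOD p] := by
  haveI : Fact p.Prime := ⟨hp⟩
  induction s with
  | zero => simp [Nat.ModEq.refl]
  | succ s ih =>
    have h1 := Choose.choose_modEq_choose_mod_mul_choose_div_nat
      (n := p ^ (s + 1) * (a + 1) - 1) (k := p ^ (s + 1)) (p := p)
    have hpos : 0 < p := hp.pos
    obtain ⟨t, ht⟩ : ∃ t, p ^ s * (a + 1) = t + 1 :=
      ⟨p ^ s * (a + 1) - 1, (Nat.succ_pred_eq_of_pos (by positivity)).symm⟩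
    have e : p ^ (s + 1) * (a + 1) - 1 = (p - 1) + p * t := by
      have : p ^ (s + 1) * (a + 1) = p * t + p := by
        rw [pow_succ, mul_right_comm, ht]; ring
      omega
    have e1 : (p ^ (s + 1) * (a + 1) - 1) / p = t := by
      rw [e, Nat.add_mul_div_left _ _ hpos, Nat.div_eq_of_lt (by omega)]; simp
    have e2 : p ^ (s + 1) / p = p ^ s := by
      rw [pow_succ]; exact Nat.mul_div_cancel _ hpos
    have e3 : p ^ (s + 1) % p = 0 := by
      rw [pow_succ]; exact Nat.mul_mod_left _ _
    rw [e1, e2, e3, Nat.choose_zero_right, one_mul] at h1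
    rw [ht, Nat.add_sub_cancel] at ih
    exact h1.trans ih

theorem steenrodP_pow (p k n : ℕ) (hp : p.Prime) :
    steenrodP p 1 k (X 0 ^ n) =
      (n.choose k : ZMod p) • (X 0 : MvPolynomial (Fin 1) (ZMod p)) ^ (n + k * (p - 1)) := by
  have key : (Polynomial.C (X 0 : MvPolynomial (Fin 1) (ZMod p)) +
      Polynomial.C (X 0 ^ p) * Polynomial.X) ^ n =
      ((1 + Polynomial.X) ^ n).comp (Polynomial.C (X 0 ^ (p - 1)) * Polynomial.X)
        * Polynomial.C (X 0 ^ n) := by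
    rw [Polynomial.pow_comp, map_pow Polynomial.C (X 0) n, ← mul_pow]
    congr 1
    obtain ⟨q, rfl⟩ : ∃ q, p = q + 1 := ⟨p - 1, (Nat.succ_pred_eq_of_pos hp.pos).symm⟩
    simp
    ring
  unfold steenrodP Phi
  rw [map_pow, aeval_X, key, Polynomial.coeff_mul_C, Polynomial.comp_C_mul_X_coeff,
    Polynomial.coeff_one_add_X_pow, Algebra.smul_def]
  simp only [map_natCast]
  ring

theorem pow_hit (p : ℕ) (hp : p.Prime) (m : ℕ)
    (hma : ¬ m ≤ p - 2)
    (hmb : ¬ ∃ i, i ≤ p - 1 ∧ m = (i + 1) * p - 1)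
    (hmc : ¬ ∃ i r, 1 ≤ i ∧ i ≤ p - 1 ∧ 2 ≤ r ∧ m = (i + 1) * p ^ r - 1) :
    (X 0 : MvPolynomial (Fin 1) (ZMod p)) ^ m ∈ Hit p 1 := by
  haveI : Fact p.Prime := ⟨hp⟩
  have h2 := hp.two_le
  obtain ⟨s, q, hq, hm⟩ := Nat.exists_eq_pow_mul_and_not_dvd (n := m + 1) (by omega) p hp.ne_one
  have hq0 : q ≠ 0 := by rintro rfl; simp at hq
  have hqp : p < q := by
    by_contra hle
    have hlt : q < p := lt_of_le_of_ne (not_lt.mp hle) (by rintro rfl; simp at hq)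
    rcases s with _ | _ | s
    · simp at hm; omega
    · apply hmb
      refine ⟨q - 1, by omega, ?_⟩
      rw [Nat.sub_add_cancel (by omega), mul_comm]
      simp at hm; omega
    · by_cases h1 : q = 1
      · subst h1
        rcases s with _ | s
        · apply hmb
          refine ⟨p - 1, le_rfl, ?_⟩
          rw [Nat.sub_add_cancel (by omega), ← pow_two]
          simp at hm; omega
        · apply hmc
          refine ⟨p - 1, s + 2, by omega, le_rfl, by omega, ?_⟩
          rw [Nat.sub_add_cancel (by omega), ← pow_succ']
          rw [mul_one] at hm
          exact Nat.eq_sub_of_add_eq hm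
      · apply hmc
        refine ⟨q - 1, s + 2, by omega, by omega, by omega, ?_⟩
        rw [Nat.sub_add_cancel (by omega), mul_comm]
        exact Nat.eq_sub_of_add_eq hm
  obtain ⟨a, rfl⟩ : ∃ a, q = p + a := ⟨q - p, by omega⟩
  have hc := choose_aux p hp a s
  have ha : (a : ZMod p) ≠ 0 := by
    rw [Ne, ZMod.natCast_eq_zero_iff]
    intro h; exact hq (by simpa using h)
  have hc' : ((p ^ s * (a + 1) - 1).choose (p ^ s) : ZMod p) ≠ 0 := by
    rw [(ZMod.natCast_eq_natCast_iff _ _ _).mpr hc]; exact ha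
  have hdeg : (p ^ s * (a + 1) - 1) + p ^ s * (p - 1) = m := by
    have hpos : 0 < p ^ s * (a + 1) := by have := hp.pos; positivity
    have : p ^ s * (a + 1) + p ^ s * (p - 1) = m + 1 := by
      rw [hm, ← mul_add]; congr 1; omega
    omega
  have hs := steenrodP_pow p (p ^ s) (p ^ s * (a + 1) - 1) hp
  rw [hdeg] at hs
  refine (Submodule.smul_mem_iff _ hc').mp ?_
  rw [← hs]
  exact Submodule.subset_span ⟨p ^ s, Nat.one_le_pow _ _ hp.pos, _, rfl⟩

/-- One-variable hit problem, hit monomials: if `m` satisfies none of the conditions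
(a) `m ≤ p-2`; (b) `m = (i+1)p - 1` with `0 ≤ i ≤ p-1`; (c) `m = (i+1)p^r - 1` with
`1 ≤ i ≤ p-1`, `r ≥ 2`; then `x^m` is hit in `P₁ = 𝔽_p[x]`, and consequently every
homogeneous polynomial of degree `m` is hit (the degree-`m` part of the quotient by the
hit polynomials is zero). -/
theorem one_var_hit (p : ℕ) (hp : p.Prime) (hodd : Odd p) (m : ℕ)
    (hma : ¬ m ≤ p - 2)
    (hmb : ¬ ∃ i, i ≤ p - 1 ∧ m = (i + 1) * p - 1)
    (hmc : ¬ ∃ i r, 1 ≤ i ∧ i ≤ p - 1 ∧ 2 ≤ r ∧ m = (i + 1) * p ^ r - 1) :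
    (X 0 : MvPolynomial (Fin 1) (ZMod p)) ^ m ∈ Hit p 1 ∧
      ∀ f : MvPolynomial (Fin 1) (ZMod p), f.IsHomogeneous m → f ∈ Hit p 1 := by
  have hx := pow_hit p hp m hma hmb hmc
  refine ⟨hx, fun f hf => ?_⟩
  rw [f.as_sum]
  refine Submodule.sum_mem _ fun d hd => ?_
  have hd0 : d 0 = m := by
    have := hf (mem_support_iff.mp hd)
    simpa [Finsupp.weight_apply, Finsupp.sum_fintype] using this
  have : monomial d (f.coeff d) = f.coeff d • (X 0 : MvPolynomial (Fin 1) (ZMod p)) ^ m := by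
    rw [monomial_eq, Finsupp.prod_fintype _ _ (by simp), smul_eq_C_mul]
    simp [hd0]
  rw [this]
  exact Submodule.smul_mem _ _ hx
end

section
/- Crossley's Theorem 1.1, third case: Let p be an odd prime and let m = ((i+1)p^r + j + 1)p^s − 2 where 1 ≤ i ≤ p−1, 0 ≤ j ≤ p−2, r ≥ 2, and s ≥ 0. Then the images of the monomials in the set { x^{(k+1)p^{s+1} − 1} y^{m − (k+1)p^{s+1} + 1} : 1 ≤ k ≤ p−1 } ∪ { x^{(j+1)p^s − 1} y^{(i+1)p^{r+s} − 1}, x^{(i+1)p^{r+s} − 1} y^{(j+1)p^s − 1} } form an 𝔽_p-basis of the quotient vector space V_m / (V_m ∩ H), where V_m ⊆ P_2 = 𝔽_p[x,y] is the subspace of homogeneous polynomials of total degree m and H ⊆ P_2 is the subspace of hit polynomials. -/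
open MvPolynomial

/-- Crossley's monomial set for degree `m = ((i+1)p^r + j + 1)p^s - 2`:
`{x^{(k+1)p^{s+1}-1} y^{m-(k+1)p^{s+1}+1} : 1 ≤ k ≤ p-1}
  ∪ {x^{(j+1)p^s-1} y^{(i+1)p^{r+s}-1}, x^{(i+1)p^{r+s}-1} y^{(j+1)p^s-1}}`. -/
noncomputable def basisSet10 (p i j r s m : ℕ) : Set (MvPolynomial (Fin 2) (ZMod p)) :=
  {g | ∃ k, 1 ≤ k ∧ k ≤ p - 1 ∧
      g = X 0 ^ ((k + 1) * p ^ (s + 1) - 1) * X 1 ^ (m - ((k + 1) * p ^ (s + 1) - 1))} ∪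
  {X 0 ^ ((j + 1) * p ^ s - 1) * X 1 ^ ((i + 1) * p ^ (r + s) - 1),
   X 0 ^ ((i + 1) * p ^ (r + s) - 1) * X 1 ^ ((j + 1) * p ^ s - 1)}

/-- A scalar sequence annihilating the hit relations in degree `m`. -/
def GoodSeq (p m : ℕ) (e : ℕ → ZMod p) : Prop :=
  ∀ k a b, 1 ≤ k → a + b + k * (p - 1) = m →
    ∑ uv ∈ Finset.HasAntidiagonal.antidiagonal k,
      (a.choose uv.1 : ZMod p) * (b.choose uv.2 : ZMod p) * e (a + uv.1 * (p - 1)) = 0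

section comb
variable {p : ℕ} [hp : Fact p.Prime]

lemma castp_ne {x : ℕ} (h0 : 0 < x) (h1 : x < p) : (x : ZMod p) ≠ 0 := by
  rw [Ne, ZMod.natCast_eq_zero_iff]
  exact fun h => absurd (Nat.le_of_dvd h0 h) (by omega)

lemma lucas_cast {a0 u0 : ℕ} (a u : ℕ) (ha : a0 < p) (hu : u0 < p) :
    ((p * a + a0).choose (p * u + u0) : ZMod p) = (a0.choose u0 : ZMod p) * (a.choose u) := by
  have h := Choose.choose_modEq_choose_mod_mul_choose_div_nat
    (n := p * a + a0) (k := p * u + u0) (p := p)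
  rw [← ZMod.natCast_eq_natCast_iff] at h
  have hpos : 0 < p := hp.out.pos
  rw [h, Nat.mul_add_mod, Nat.mul_add_mod, Nat.mod_eq_of_lt ha, Nat.mod_eq_of_lt hu,
    Nat.mul_add_div hpos, Nat.mul_add_div hpos, Nat.div_eq_of_lt ha, Nat.div_eq_of_lt hu]
  simp

lemma GoodSeq.one {m : ℕ} {e : ℕ → ZMod p} (h : GoodSeq p m e) {a b : ℕ}
    (hab : a + b + (p - 1) = m) : (a : ZMod p) * e (a + (p - 1)) + b * e a = 0 := by
  have := h 1 a b le_rfl (by simpa using hab)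
  simp [Finset.Nat.antidiagonal_succ] at this
  linear_combination this

lemma GoodSeq.symm {m : ℕ} {e : ℕ → ZMod p} (h : GoodSeq p m e) :
    GoodSeq p m (fun n => e (m - n)) := by
  intro k a b hk hab
  rw [← h k b a hk (by omega), ← Finset.Nat.sum_antidiagonal_swap]
  refine Finset.sum_congr rfl fun uv huv => ?_
  rw [Finset.HasAntidiagonal.mem_antidiagonal] at huv
  have : m - (a + uv.2 * (p - 1)) = b + uv.1 * (p - 1) := by
    rw [← hab, ← huv, add_mul]; omega
  simp only [Prod.swap, this]
  ring

lemma GoodSeq.up {m N j : ℕ} {e : ℕ → ZMod p} (h : GoodSeq p m e) (hm : m + 1 = p * N + j)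
    (hj : j < p) (t : ℕ) : ∀ n c, t < j → n + 1 + t = p * c + j → (t + 1) * (p - 1) ≤ n →
      n ≤ m → e n = 0 := by
  have hp1 := hp.out.one_lt
  induction t with
  | zero =>
    intro n c ht hn h1 h2
    have := h.one (a := n - (p - 1)) (b := m - n) (by omega)
    have e1 : ((n - (p - 1) + p : ℕ) : ZMod p) = ((p * c + j : ℕ) : ZMod p) := by
      congr 1; omega
    have e2 : ((n - (p - 1) + (m - n) + p : ℕ) : ZMod p) = ((p * N + j : ℕ) : ZMod p) := by
      congr 1; omega
    push_cast [-Nat.cast_sub] at e1 e2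
    simp only [CharP.cast_eq_zero, zero_mul, add_zero, zero_add] at e1 e2
    rw [e1] at e2 this
    have e3 : ((m - n : ℕ) : ZMod p) = 0 := by linear_combination e2
    rw [e3, show n - (p - 1) + (p - 1) = n by omega] at this
    simpa [castp_ne ht hj] using this
  | succ t ih =>
    intro n c ht hn h1 h2
    have h1' : (t + 1) * (p - 1) + (p - 1) ≤ n := by
      calc _ = (t + 1 + 1) * (p - 1) := by ring
        _ ≤ n := h1
    obtain _ | c := c
    · omega
    rw [mul_add, mul_one] at hn
    have hz := ih (n - (p - 1)) c (by omega) (by omega) (by omega) (by omega)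
    have := h.one (a := n - (p - 1)) (b := m - n) (by omega)
    rw [hz, show n - (p - 1) + (p - 1) = n by omega] at this
    have e1 : ((n - (p - 1) : ℕ) : ZMod p) = ((j - (t + 1) : ℕ) : ZMod p) := by
      have : n - (p - 1) = p * c + (j - (t + 1)) := by omega
      rw [this]; simp
    rw [e1] at this
    simpa [castp_ne (p := p) (x := j - (t + 1)) (by omega) (by omega)] using this

lemma GoodSeq.zero {m N j : ℕ} {e : ℕ → ZMod p} (h : GoodSeq p m e) (hm : m + 1 = p * N + j)
    (hj : j < p) (hbig : 2 * (p * (p - 1)) ≤ m) {n : ℕ} (hn : n ≤ m) (hnj : n % p < j) :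
    e n = 0 := by
  have hp1 := hp.out.one_lt
  have hdm := Nat.div_add_mod n p
  by_cases hc : p * (p - 1) ≤ n
  · refine h.up hm hj (j - 1 - n % p) n (n / p) (by omega) (by omega) ?_ hn
    refine le_trans (Nat.mul_le_mul_right _ ?_) hc
    omega
  · have hcN : n / p ≤ N := by
      by_contra hcon
      have : p * (N + 1) ≤ p * (n / p) := Nat.mul_le_mul_left _ (by omega)
      rw [mul_add] at this
      omega
    obtain ⟨w, hw⟩ := Nat.exists_eq_add_of_le hcN
    have hw' : p * N = p * (n / p) + p * w := by rw [← mul_add, ← hw]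
    have := h.symm.up hm hj (n % p) (m - n) w hnj (by omega) ?_ (by omega)
    · simpa [Nat.sub_sub_self hn] using this
    · refine le_trans (Nat.mul_le_mul_right _ (show n % p + 1 ≤ p by omega)) ?_
      omega

lemma GoodSeq.kameko {m : ℕ} {e : ℕ → ZMod p} (h : GoodSeq p (p * m + 2 * p - 2) e)
    (hz : ∀ n ≤ p * m + 2 * p - 2, n % p < p - 1 → e n = 0) :
    GoodSeq p m (fun n => e (p * n + (p - 1))) := by
  have hp1 := hp.out.one_lt
  have hpos : 0 < p := by omega
  intro k a b hk hab
  have hdeg : (p * a + (p - 1)) + (p * b + (p - 1)) + (p * k) * (p - 1) = p * m + 2 * p - 2 := by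
    rw [← hab]
    have : p * (a + b + k * (p - 1)) = p * a + p * b + p * k * (p - 1) := by ring
    omega
  rw [← h (p * k) (p * a + (p - 1)) (p * b + (p - 1)) (Nat.mul_pos hpos hk) hdeg]
  refine Finset.sum_of_injOn (fun uv => (p * uv.1, p * uv.2)) ?_ ?_ ?_ ?_
  · rintro ⟨u, v⟩ - ⟨u', v'⟩ - huv
    simp only [Prod.mk.injEq] at huv ⊢
    exact ⟨Nat.eq_of_mul_eq_mul_left hpos huv.1, Nat.eq_of_mul_eq_mul_left hpos huv.2⟩
  · rintro ⟨u, v⟩ huv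
    simp only [Finset.mem_coe,
      Finset.HasAntidiagonal.mem_antidiagonal] at huv ⊢
    rw [← huv, mul_add]
  · rintro ⟨u, v⟩ huv hni
    rw [Finset.HasAntidiagonal.mem_antidiagonal] at huv
    simp only at huv ⊢
    by_cases hd : p ∣ u
    · exfalso
      obtain ⟨u', rfl⟩ := hd
      have hd2 : p ∣ v := (Nat.dvd_add_right (Dvd.intro _ rfl)).1 (huv ▸ Dvd.intro _ rfl)
      obtain ⟨v', rfl⟩ := hd2
      refine hni ⟨(u', v'), ?_, rfl⟩
      rw [← mul_add] at huv
      simpa using Nat.eq_of_mul_eq_mul_left hpos huv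
    · rw [hz, mul_zero]
      · rw [← hdeg, ← huv, add_mul]; omega
      · have : (p * a + (p - 1) + u * (p - 1)) % p ≠ p - 1 := by
          intro hcon
          apply hd
          have e1 : ((p * a + (p - 1) + u * (p - 1) : ℕ) : ZMod p) = ((p - 1 : ℕ) : ZMod p) := by
            rw [← ZMod.natCast_mod, hcon]
          push_cast [Nat.cast_sub hp1.le] at e1
          rw [← ZMod.natCast_eq_zero_iff]
          simp at e1
          exact e1
        have := Nat.mod_lt (p * a + (p - 1) + u * (p - 1)) hpos
        omega
  · rintro ⟨u, v⟩ huv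
    have l1 := lucas_cast (p := p) (a0 := p - 1) (u0 := 0) a u (by omega) hpos
    have l2 := lucas_cast (p := p) (a0 := p - 1) (u0 := 0) b v (by omega) hpos
    simp only [add_zero, Nat.choose_zero_right, Nat.cast_one, one_mul] at l1 l2
    simp only [l1, l2]
    congr 2
    ring

section base

lemma GoodSeq.step1 {m N j : ℕ} {e : ℕ → ZMod p} (h : GoodSeq p m e)
    (hm : m + 1 = p * N + j) (hj : j + 2 ≤ p) {q t : ℕ} (hq : 1 ≤ q) (hqN : q + 1 ≤ N) (ht : t + 1 + j < p) :
    e (p * q - 1 - t) = 0 ↔ e (p * (q + 1) - 1 - (t + 1)) = 0 := by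
  have hp1 := hp.out.one_lt
  have hqp : p * 1 ≤ p * q := Nat.mul_le_mul_left _ hq
  have hqN' : p * (q + 1) ≤ p * N := Nat.mul_le_mul_left _ hqN
  rw [mul_add, mul_one] at *
  obtain ⟨w, hw⟩ := Nat.exists_eq_add_of_le hqN
  have hw' : p * N = p * q + p + p * w := by rw [hw]; ring
  have := h.one (a := p * q - 1 - t) (b := p * w + (j + t + 1)) (by omega)
  rw [show p * q - 1 - t + (p - 1) = p * q + p - 1 - (t + 1) by omega] at this
  have e1 : ((p * q - 1 - t : ℕ) : ZMod p) = -((t + 1 : ℕ) : ZMod p) := by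
    have e0 : ((p * q - 1 - t + (t + 1) : ℕ) : ZMod p) = ((p * q : ℕ) : ZMod p) := by
      congr 1; omega
    rw [Nat.cast_add] at e0
    simp only [Nat.cast_mul, CharP.cast_eq_zero, zero_mul] at e0
    linear_combination e0
  have e2 : ((p * w + (j + t + 1) : ℕ) : ZMod p) = ((j + t + 1 : ℕ) : ZMod p) := by
    rw [Nat.cast_add]; simp
  rw [e1, e2] at this
  have n1 := castp_ne (p := p) (x := t + 1) (by omega) (by omega)
  have n2 := castp_ne (p := p) (x := j + t + 1) (by omega) (by omega)
  constructor
  · intro h0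
    rw [h0, mul_zero, add_zero] at this
    exact (mul_eq_zero.1 this).resolve_left (neg_ne_zero.2 n1)
  · intro h0
    rw [h0, mul_zero, zero_add] at this
    exact (mul_eq_zero.1 this).resolve_left n2

lemma GoodSeq.step2 {m N j : ℕ} {e : ℕ → ZMod p} (h : GoodSeq p m e)
    (hm : m + 1 = p * N + j) (hj : j + 2 ≤ p) (hbig : 2 * (p * (p - 1)) ≤ m) (hN : p ∣ N) {q t : ℕ}
    (hqN : q + p ≤ N) (ht : t + j < p) (hq : (q : ZMod p) ≠ 0) :
    e (p * (q + 1) - 1 - t) = 0 ↔ e (p * (q + p) - 1 - t) = 0 := by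
  have hp1 := hp.out.one_lt
  obtain ⟨w, hw⟩ := Nat.exists_eq_add_of_le hqN
  have hw' : p * N = p * q + p * p + p * w := by rw [hw]; ring
  have hpp : p * (p - 1) + p = p * p := by
    rw [← Nat.mul_succ]; congr 1; omega
  have hdeg : (p * q + (p - 1 - t)) + (p * w + (j + t)) + p * (p - 1) = m := by omega
  have key := h p _ _ hp1.le hdeg
  rw [Finset.sum_eq_add (0, p) (p, 0)] at key
  · have l1 := lucas_cast (p := p) (a0 := p - 1 - t) (u0 := 0) q 1 (by omega) (by omega)
    have l2 := lucas_cast (p := p) (a0 := j + t) (u0 := 0) w 1 (by omega) (by omega)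
    simp only [add_zero, Nat.choose_zero_right, Nat.cast_one, one_mul, mul_one,
      Nat.choose_one_right] at l1 l2
    simp only [l1, l2, Nat.choose_zero_right, Nat.cast_one, one_mul, mul_one, zero_mul,
      add_zero] at key
    have e1 : p * q + (p - 1 - t) = p * (q + 1) - 1 - t := by rw [mul_add]; omega
    have e2 : p * q + (p - 1 - t) + p * (p - 1) = p * (q + p) - 1 - t := by
      rw [mul_add]; omega
    rw [e2, e1] at key
    have e3 : (w : ZMod p) = - q := by
      have : ((q + p + w : ℕ) : ZMod p) = 0 := by
        rw [ZMod.natCast_eq_zero_iff, ← hw]; exact hN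
      push_cast at this
      simp at this
      linear_combination this
    rw [e3] at key
    have : (q : ZMod p) * (e (p * (q + p) - 1 - t) - e (p * (q + 1) - 1 - t)) = 0 := by
      linear_combination key
    have := (mul_eq_zero.1 this).resolve_left hq
    rw [sub_eq_zero] at this
    rw [this]
  · intro hcon; simp at hcon; omega
  · rintro ⟨u, v⟩ huv ⟨h1, h2⟩
    rw [Finset.HasAntidiagonal.mem_antidiagonal] at huv
    simp only at huv ⊢
    have hu : u ≠ 0 := by rintro rfl; apply h1; simp at huv; simp [huv]
    have hv : v ≠ 0 := by rintro rfl; apply h2; simp at huv; simp [huv]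
    have l1 := lucas_cast (p := p) (a0 := p - 1 - t) (u0 := u) q 0 (by omega) (by omega)
    have l2 := lucas_cast (p := p) (a0 := j + t) (u0 := v) w 0 (by omega) (by omega)
    simp only [mul_zero, zero_add, Nat.choose_zero_right, Nat.cast_one, mul_one] at l1 l2
    rw [l1, l2]
    by_cases c1 : p - 1 - t < u
    · rw [Nat.choose_eq_zero_of_lt c1]; simp
    by_cases c2 : j + t < v
    · rw [Nat.choose_eq_zero_of_lt c2]; simp
    rw [h.zero hm (by omega) hbig, mul_zero]
    · have : u * (p - 1) ≤ p * (p - 1) := Nat.mul_le_mul_right _ (by omega)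
      omega
    · have : u * (p - 1) + u = p * u := by
        rw [← Nat.mul_succ, mul_comm]; congr 1; omega
      have e4 : p * q + (p - 1 - t) + u * (p - 1) = p * (q + u) + (p - 1 - t - u) := by
        rw [mul_add]; omega
      rw [e4, Nat.mul_add_mod, Nat.mod_eq_of_lt] <;> omega
  · intro hcon; simp at hcon
  · intro hcon; simp at hcon

lemma GoodSeq.base {m N j : ℕ} {e : ℕ → ZMod p} (h : GoodSeq p m e)
    (hm : m + 1 = p * N + j) (hj : j + 2 ≤ p) (hN : p ∣ N) (hN2 : 2 * p ≤ N) (hj0 : e j = 0) (hN0 : e (p * N - 1) = 0)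
    (hc0 : ∀ c, 2 ≤ c → c ≤ p → e (p * c - 1) = 0) : ∀ n ≤ m, e n = 0 := by
  have hp1 := hp.out.one_lt
  have hpp : p * (p - 1) + p = p * p := by
    rw [← Nat.mul_succ]; congr 1; omega
  have hNp : p * (2 * p) ≤ p * N := Nat.mul_le_mul_left _ hN2
  have hbig : 2 * (p * (p - 1)) ≤ m := by
    have : p * (2 * p) = 2 * (p * p) := by ring
    omega
  -- step 3
  have step3 : ∀ c, 1 ≤ c → c + p ≤ N →
      (e (p * c - 1) = 0 ↔ e (p * (c + p - 1) - 1) = 0) := by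
    intro c hc hcN
    obtain ⟨q, rfl⟩ : ∃ q, c = q + 1 := ⟨c - 1, by omega⟩
    by_cases hq : (q : ZMod p) = 0
    · have s1 := h.step1 hm hj (q := q + 1) (t := 0) (by omega) (by omega) (by omega)
      have s2 := h.step2 hm hj hbig hN (q := q + 1) (t := 1) (by omega) (by omega)
        (by push_cast; rw [hq]; simp)
      have s3 := h.step1 hm hj (q := q + p) (t := 0) (by omega) (by omega) (by omega)
      simp only [Nat.sub_zero, zero_add] at s1 s3
      rw [show q + 1 + p - 1 = q + p by omega, s1, s3, s2,
        show q + 1 + p = q + p + 1 by omega]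
    · have s2 := h.step2 hm hj hbig hN (q := q) (t := 0) (by omega) (by omega) hq
      simp only [Nat.sub_zero] at s2
      rw [show q + 1 + p - 1 = q + p by omega, s2]
  have all0 : ∀ c, 1 ≤ c → c ≤ N → e (p * c - 1) = 0 := by
    intro c
    induction c using Nat.strong_induction_on with
    | _ c ih =>
      intro h1 h2
      by_cases hcN : c = N
      · rw [hcN]; exact hN0
      by_cases hc1 : c = 1
      · rw [hc1, step3 1 le_rfl (by omega), show 1 + p - 1 = p by omega]
        exact hc0 p (by omega) le_rfl
      by_cases hcp : c ≤ p
      · exact hc0 c (by omega) hcp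
      have := (step3 (c - (p - 1)) (by omega) (by omega)).1 (ih _ (by omega) (by omega) (by omega))
      rwa [show c - (p - 1) + p - 1 = c by omega] at this
  have allt : ∀ t q, t + j < p → t < q → q ≤ N → e (p * q - 1 - t) = 0 := by
    intro t
    induction t with
    | zero => intro q _ h1 h2; simpa using all0 q h1 h2
    | succ t ih =>
      intro q h1 h2 h3
      have := (h.step1 hm hj (q := q - 1) (t := t) (by omega) (by omega) (by omega)).1
        (ih (q - 1) (by omega) (by omega) (by omega))
      rwa [show q - 1 + 1 = q by omega] at this
  have low : ∀ d t q, t + j + d + 1 = p → 1 ≤ q → q ≤ t → e (p * q - 1 - t) = 0 := by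
    intro d
    induction d with
    | zero =>
      intro t q ht h1 h2
      by_cases hq : q = 1
      · rw [hq, mul_one, show p - 1 - t = j by omega]; exact hj0
      · obtain ⟨q, rfl⟩ : ∃ q', q = q' + 1 := ⟨q - 1, by omega⟩
        rw [h.step2 hm hj hbig hN (by omega) (by omega)
          (castp_ne (by omega) (by omega))]
        exact allt _ _ (by omega) (by omega) (by omega)
    | succ d ih =>
      intro t q ht h1 h2
      rw [h.step1 hm hj h1 (by omega) (by omega)]
      exact ih _ _ (by omega) (by omega) (by omega)
  intro n hn
  by_cases hnj : n % p < j
  · exact h.zero hm (by omega) hbig hn hnj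
  · have hdm := Nat.div_add_mod n p
    have hlt := Nat.mod_lt n (show 0 < p by omega)
    have hqN : n / p + 1 ≤ N := by
      by_contra hcon
      have : p * N ≤ p * (n / p) := Nat.mul_le_mul_left _ (by omega)
      omega
    have hform : n = p * (n / p + 1) - 1 - (p - 1 - n % p) := by
      rw [mul_add]; omega
    rw [hform]
    by_cases hc : p - 1 - n % p < n / p + 1
    · exact allt _ _ (by omega) hc hqN
    · exact low (n % p - j) _ _ (by omega) (Nat.le_add_left _ _) (Nat.le_of_not_lt hc)
end base

lemma GoodSeq.all {i j r : ℕ} (hi1 : 1 ≤ i) (hj : j + 2 ≤ p) (hr : 2 ≤ r) (s : ℕ) :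
    ∀ (m : ℕ) (e : ℕ → ZMod p), m + 2 = ((i + 1) * p ^ r + j + 1) * p ^ s → GoodSeq p m e →
    (∀ k, 1 ≤ k → k ≤ p - 1 → e ((k + 1) * p ^ (s + 1) - 1) = 0) →
    e ((j + 1) * p ^ s - 1) = 0 → e ((i + 1) * p ^ (r + s) - 1) = 0 → ∀ n ≤ m, e n = 0 := by
  have hp1 := hp.out.one_lt
  have hpr : 2 * p ≤ (i + 1) * p ^ (r - 1) := by
    have : p ^ 1 ≤ p ^ (r - 1) := Nat.pow_le_pow_right (by omega) (by omega)
    rw [pow_one] at this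
    exact Nat.mul_le_mul (by omega) this
  have hpN : p * ((i + 1) * p ^ (r - 1)) = (i + 1) * p ^ r := by
    obtain ⟨r, rfl⟩ : ∃ r', r = r' + 1 := ⟨r - 1, by omega⟩
    rw [Nat.add_sub_cancel, pow_succ]; ring
  have hpp : p * (p - 1) + p = p * p := by
    rw [← Nat.mul_succ]; congr 1; omega
  have hNp : p * (2 * p) ≤ p * ((i + 1) * p ^ (r - 1)) := Nat.mul_le_mul_left _ hpr
  have h2p : p * (2 * p) = 2 * (p * p) := by ring
  induction s with
  | zero =>
    intro m e hm h h1 h2 h3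
    simp only [pow_zero, mul_one, add_zero, zero_add, pow_one, Nat.add_sub_cancel] at *
    refine h.base (N := (i + 1) * p ^ (r - 1)) (j := j) (by omega) hj ?_ hpr h2 ?_ ?_
    · refine Dvd.dvd.mul_left (dvd_pow_self _ (by omega)) _
    · rw [hpN]; exact h3
    · intro c hc hcp
      have := h1 (c - 1) (by omega) (by omega)
      rwa [show c - 1 + 1 = c by omega, mul_comm] at this
  | succ s ih =>
    intro m e hm h h1 h2 h3
    set D := ((i + 1) * p ^ r + j + 1) * p ^ s with hD
    have hDbig : 2 * (p * p) ≤ D := by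
      have : 1 ≤ p ^ s := Nat.one_le_pow _ _ (by omega)
      calc _ ≤ ((i + 1) * p ^ r + j + 1) * 1 := by omega
        _ ≤ _ := Nat.mul_le_mul_left _ this
    have hmD : m + 2 = p * D := by rw [hm, hD, pow_succ]; ring
    have hpD : p * (D - 2) + 2 * p = p * D := by
      rw [mul_comm 2 p, ← mul_add]; congr 1; omega
    have hpD1 : p * (D - 1) + p = p * D := by
      rw [← Nat.mul_succ]; congr 1; omega
    have hm' : m = p * (D - 2) + 2 * p - 2 := by omega
    have hDp : 1 * D ≤ p * D := Nat.mul_le_mul_right _ (by omega)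
    have hz : ∀ n ≤ m, n % p < p - 1 → e n = 0 := fun n hn hnp =>
      h.zero (N := D - 1) (j := p - 1) (by omega) (by omega) (by omega) hn hnp
    have shift : ∀ x t, 1 ≤ x → p * (x * p ^ t - 1) + (p - 1) = x * p ^ (t + 1) - 1 := by
      intro x t hx
      have : 1 ≤ x * p ^ t := Nat.mul_pos hx (Nat.pow_pos (by omega))
      have e1 : x * p ^ (t + 1) = p * (x * p ^ t - 1) + p := by
        rw [← Nat.mul_succ, Nat.succ_eq_add_one, Nat.sub_add_cancel this]; ring
      omega
    have hall := ih (D - 2) (fun n => e (p * n + (p - 1))) (by omega)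
      (GoodSeq.kameko (hm' ▸ h) (hm' ▸ hz))
      (fun k hk1 hk2 => by simpa only [shift _ _ (show 1 ≤ k + 1 by omega)] using h1 k hk1 hk2)
      (by simpa only [shift _ _ (show 1 ≤ j + 1 by omega)] using h2)
      (by simpa only [shift _ _ (show 1 ≤ i + 1 by omega), add_assoc] using h3)
    intro n hn
    by_cases hnp : n % p < p - 1
    · exact hz n hn hnp
    · have hdm := Nat.div_add_mod n p
      have hlt := Nat.mod_lt n (show 0 < p by omega)
      have hle : n / p ≤ D - 2 := by
        by_contra hcon
        have : p * (D - 2 + 1) ≤ p * (n / p) := Nat.mul_le_mul_left _ (by omega)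
        rw [mul_add] at this
        omega
      have := hall _ hle
      rwa [show p * (n / p) + (p - 1) = n by omega] at this

lemma spike (t : ℕ) : ∀ d c u, 1 ≤ d → d ≤ p → 1 ≤ u → c + u * (p - 1) + 1 = d * p ^ t →
    (c.choose u : ZMod p) = 0 := by
  have hp1 := hp.out.one_lt
  induction t with
  | zero =>
    intro d c u h1 h2 hu h
    have : 1 * (p - 1) ≤ u * (p - 1) := Nat.mul_le_mul_right _ hu
    rw [pow_zero, mul_one] at h
    have hc : c = 0 := by omega
    rw [hc, Nat.choose_eq_zero_of_lt (by omega), Nat.cast_zero]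
  | succ t ih =>
    intro d c u h1 h2 hu h
    have hc := Nat.div_add_mod c p
    have hu' := Nat.div_add_mod u p
    have hlc := Nat.mod_lt c (show 0 < p by omega)
    have hlu := Nat.mod_lt u (show 0 < p by omega)
    rw [← hc, ← hu', lucas_cast _ _ hlc hlu]
    by_cases hlt : c % p < u % p
    · rw [Nat.choose_eq_zero_of_lt hlt]; simp
    have e1 : ((c + 1 : ℕ) : ZMod p) = ((u : ℕ) : ZMod p) := by
      have : ((c + u * (p - 1) + 1 : ℕ) : ZMod p) = ((d * p ^ (t + 1) : ℕ) : ZMod p) := by rw [h]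
      push_cast [Nat.cast_sub hp1.le] at this ⊢
      simp at this
      linear_combination this
    rw [ZMod.natCast_eq_natCast_iff', Nat.add_mod, Nat.mod_eq_of_lt hp1] at e1
    have hcp : c % p = p - 1 := by
      by_contra hne
      rw [Nat.mod_eq_of_lt (by omega)] at e1
      omega
    have hup : u % p = 0 := by
      rw [← e1, hcp, Nat.sub_add_cancel hp1.le, Nat.mod_self]
    rw [ih d (c / p) (u / p) h1 h2, mul_zero]
    · by_contra h0
      have : u / p = 0 := Nat.eq_zero_of_not_pos h0
      rw [this, hup] at hu'
      omega
    · have : p * (c / p + u / p * (p - 1) + 1) = p * (d * p ^ t) := by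
        have e2 : p * (d * p ^ t) = d * p ^ (t + 1) := by rw [pow_succ]; ring
        have e3 : u * (p - 1) = p * (u / p * (p - 1)) := by
          conv_lhs => rw [← hu', hup]
          ring
        rw [e2, ← h, e3, mul_add, mul_add]
        omega
      exact Nat.eq_of_mul_eq_mul_left (by omega) this
end comb

section poly
variable {p : ℕ} [hp : Fact p.Prime]

/-- The two-variable monomial with exponents `a`, `b`. -/
noncomputable def mon (p a b : ℕ) : MvPolynomial (Fin 2) (ZMod p) := X 0 ^ a * X 1 ^ b

lemma coeff_gen_pow (x : MvPolynomial (Fin 2) (ZMod p)) (a u : ℕ) :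
    ((Polynomial.C x + Polynomial.C (x ^ p) * Polynomial.X) ^ a).coeff u
      = (a.choose u : MvPolynomial (Fin 2) (ZMod p)) * x ^ (a + u * (p - 1)) := by
  have hp1 := hp.out.one_lt
  have e1 : Polynomial.C x + Polynomial.C (x ^ p) * Polynomial.X
      = Polynomial.C x * ((1 + Polynomial.X : Polynomial (MvPolynomial (Fin 2) (ZMod p))).comp
          (Polynomial.C (x ^ (p - 1)) * Polynomial.X)) := by
    have : x ^ p = x * x ^ (p - 1) := by rw [← pow_succ']; congr 1; omega
    rw [this]
    simp
    ring
  rw [e1, mul_pow, ← Polynomial.pow_comp, ← Polynomial.C_pow, Polynomial.coeff_C_mul,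
    Polynomial.comp_C_mul_X_coeff, Polynomial.coeff_one_add_X_pow]
  ring

lemma steenrod_mon (k a b : ℕ) : steenrodP p 2 k (mon p a b) =
    ∑ uv ∈ Finset.HasAntidiagonal.antidiagonal k,
      ((a.choose uv.1 : ZMod p) * (b.choose uv.2 : ZMod p)) •
        mon p (a + uv.1 * (p - 1)) (b + uv.2 * (p - 1)) := by
  unfold steenrodP Phi mon
  rw [map_mul, map_pow, map_pow, aeval_X, aeval_X, Polynomial.coeff_mul]
  refine Finset.sum_congr rfl fun uv _ => ?_
  rw [coeff_gen_pow, coeff_gen_pow, MvPolynomial.smul_eq_C_mul]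
  simp only [map_mul, map_natCast]
  ring

lemma mon_eq_monomial (a b : ℕ) : mon p a b = monomial (Finsupp.single 0 a + Finsupp.single 1 b) 1 := by
  unfold mon
  rw [X_pow_eq_monomial, X_pow_eq_monomial, monomial_mul, one_mul]

lemma exists_mon (d : Fin 2 →₀ ℕ) : monomial d (1 : ZMod p) = mon p (d 0) (d 1) := by
  have : d = Finsupp.single 0 (d 0) + Finsupp.single 1 (d 1) := by
    ext i
    fin_cases i <;> simp
  rw [mon_eq_monomial, ← this]

lemma coeff_mon (a b c d : ℕ) :
    coeff (Finsupp.single 0 a + Finsupp.single 1 b) (mon p c d)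
      = if c = a ∧ d = b then 1 else 0 := by
  rw [mon_eq_monomial, coeff_monomial]
  refine if_congr ?_ rfl rfl
  constructor
  · intro h
    have h0 := DFunLike.congr_fun h 0
    have h1 := DFunLike.congr_fun h 1
    simp at h0 h1
    exact ⟨h0, h1⟩
  · rintro ⟨rfl, rfl⟩; rfl

lemma steenrodP_add (k : ℕ) (f g : MvPolynomial (Fin 2) (ZMod p)) :
    steenrodP p 2 k (f + g) = steenrodP p 2 k f + steenrodP p 2 k g := by
  simp [steenrodP]

lemma steenrodP_smul (k : ℕ) (c : ZMod p) (f : MvPolynomial (Fin 2) (ZMod p)) :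
    steenrodP p 2 k (c • f) = c • steenrodP p 2 k f := by
  simp [steenrodP]

lemma coeff_steenrod {d d' t t' a b : ℕ} (h1 : 1 ≤ d) (h2 : d ≤ p) (h1' : 1 ≤ d') (h2' : d' ≤ p)
    (ha : a + 1 = d * p ^ t) (hb : b + 1 = d' * p ^ t') {k : ℕ} (hk : 1 ≤ k)
    (f : MvPolynomial (Fin 2) (ZMod p)) :
    coeff (Finsupp.single 0 a + Finsupp.single 1 b) (steenrodP p 2 k f) = 0 := by
  induction f using MvPolynomial.induction_on' with
  | add f g hf hg => rw [steenrodP_add, coeff_add, hf, hg, add_zero]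
  | monomial n c =>
    have : monomial n c = c • mon p (n 0) (n 1) := by
      rw [← exists_mon, smul_monomial, smul_eq_mul, mul_one]
    rw [this, steenrodP_smul, coeff_smul, steenrod_mon, coeff_sum]
    rw [Finset.sum_eq_zero, smul_zero]
    rintro ⟨u, v⟩ huv
    rw [Finset.HasAntidiagonal.mem_antidiagonal] at huv
    simp only at huv ⊢
    rw [coeff_smul, coeff_mon]
    split_ifs with hc
    · obtain ⟨hc1, hc2⟩ := hc
      by_cases hu : 1 ≤ u
      · rw [spike t d _ u h1 h2 hu (by rw [hc1, ha])]; simp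
      · rw [spike t' d' (n 1) v h1' h2' (by omega) (by rw [hc2, hb])]; simp
    · simp

/-- Substitution `x ↦ x + l y`, `y ↦ y`. -/
noncomputable def subst (p : ℕ) (l : ZMod p) :
    MvPolynomial (Fin 2) (ZMod p) →ₐ[ZMod p] MvPolynomial (Fin 2) (ZMod p) :=
  aeval ![X 0 + C l * X 1, X 1]

lemma Phi_subst (l : ZMod p) (f : MvPolynomial (Fin 2) (ZMod p)) :
    Phi p 2 (subst p l f) = (Phi p 2 f).map (subst p l).toRingHom := by
  have : (Phi p 2).comp (subst p l) = (Polynomial.mapAlgHom (subst p l)).comp (Phi p 2) := by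
    apply MvPolynomial.algHom_ext
    intro i
    have hC : Phi p 2 (C l) = Polynomial.C (C l) := by
      rw [← MvPolynomial.algebraMap_eq, AlgHom.commutes]; rfl
    fin_cases i
    · simp only [AlgHom.comp_apply, subst, aeval_X, Fin.zero_eta, Matrix.cons_val_zero, map_add,
        map_mul, hC]
      have hpow : (X 0 + C l * X 1 : MvPolynomial (Fin 2) (ZMod p)) ^ p
          = X 0 ^ p + C l * X 1 ^ p := by
        rw [add_pow_char, mul_pow, ← map_pow, ZMod.pow_card]
      simp only [Phi, aeval_X, map_add, map_mul, Polynomial.coe_mapAlgHom, Polynomial.map_C,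
        Polynomial.map_X, RingHom.coe_coe, map_pow, Polynomial.map_pow, Polynomial.map_add,
        Polynomial.map_mul, Matrix.cons_val_zero]
      have hpow2 := congrArg Polynomial.C hpow
      simp only [map_add, map_mul, map_pow] at hpow2
      rw [hpow2]
      ring
    · simp [subst, Phi]
  exact DFunLike.congr_fun this f

lemma steenrod_subst (l : ZMod p) (k : ℕ) (f : MvPolynomial (Fin 2) (ZMod p)) :
    subst p l (steenrodP p 2 k f) = steenrodP p 2 k (subst p l f) := by
  unfold steenrodP
  rw [Phi_subst, Polynomial.coeff_map]; rfl

/-- The functional used to detect non-hit elements. -/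
noncomputable def Lfun (p : ℕ) (l : ZMod p) (a b : ℕ) :
    MvPolynomial (Fin 2) (ZMod p) →ₗ[ZMod p] ZMod p :=
  (MvPolynomial.lcoeff (ZMod p) (Finsupp.single 0 a + Finsupp.single 1 b)) ∘ₗ
    (subst p l).toLinearMap

lemma Lfun_hit {d d' t t' a b : ℕ} (l : ZMod p) (h1 : 1 ≤ d) (h2 : d ≤ p) (h1' : 1 ≤ d')
    (h2' : d' ≤ p) (ha : a + 1 = d * p ^ t) (hb : b + 1 = d' * p ^ t')
    {f : MvPolynomial (Fin 2) (ZMod p)} (hf : f ∈ Hit p 2) : Lfun p l a b f = 0 := by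
  have : Hit p 2 ≤ LinearMap.ker (Lfun p l a b) := by
    refine Submodule.span_le.2 ?_
    rintro g ⟨k, hk, u, rfl⟩
    simp only [SetLike.mem_coe, LinearMap.mem_ker, Lfun, LinearMap.comp_apply,
      AlgHom.toLinearMap_apply, steenrod_subst]
    exact coeff_steenrod h1 h2 h1' h2' ha hb hk _
  exact this hf

lemma Lfun_mon (l : ZMod p) {a b n k : ℕ} (h : n + k = a + b) :
    Lfun p l a b (mon p n k) = (n.choose a : ZMod p) * l ^ (n - a) := by
  have e : subst p l (mon p n k) = ∑ u ∈ Finset.range (n + 1),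
      ((n.choose u : ZMod p) * l ^ (n - u)) • mon p u (n - u + k) := by
    unfold subst mon
    simp only [map_mul, map_pow, aeval_X, Matrix.cons_val_zero, Matrix.cons_val_one]
    rw [add_pow, Finset.sum_mul]
    refine Finset.sum_congr rfl fun u _ => ?_
    rw [MvPolynomial.smul_eq_C_mul]
    simp only [map_mul, map_natCast, map_pow, mul_pow, pow_add]
    ring
  simp only [Lfun, LinearMap.comp_apply, AlgHom.toLinearMap_apply, e, map_sum]
  have e2 : ∀ u, MvPolynomial.lcoeff (ZMod p) (Finsupp.single 0 a + Finsupp.single 1 b)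
      (((n.choose u : ZMod p) * l ^ (n - u)) • mon p u (n - u + k)) =
      if u = a then (if n - u + k = b then (n.choose a : ZMod p) * l ^ (n - a) else 0) else 0 := by
    intro u
    rw [map_smul, MvPolynomial.lcoeff_apply, coeff_mon]
    by_cases hu : u = a
    · subst hu; by_cases hb : n - u + k = b <;> simp [hb]
    · simp [hu]
  simp only [e2]
  rw [Finset.sum_ite_eq']
  split_ifs with h1 h2
  · rfl
  · rw [Finset.mem_range] at h1; omega
  · rw [Finset.mem_range] at h1
    rw [Nat.choose_eq_zero_of_lt (by omega)]; simp

lemma Lfun_zero_mon {a b n k : ℕ} (h : n + k = a + b) :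
    Lfun p 0 a b (mon p n k) = if n = a then 1 else 0 := by
  rw [Lfun_mon _ h]
  split_ifs with h1
  · simp [h1]
  · by_cases h2 : n < a
    · rw [Nat.choose_eq_zero_of_lt h2]; simp
    · rw [zero_pow (by omega)]; simp

lemma vander (c : Fin (p - 1) → ZMod p)
    (h : ∀ l : ZMod p, l ≠ 0 → ∑ k, c k * l ^ (k : ℕ) = 0) : ∀ k, c k = 0 := by
  have hp1 := hp.out.one_lt
  set f : Polynomial (ZMod p) := ∑ k : Fin (p - 1), Polynomial.monomial (k : ℕ) (c k) with hf
  have hdeg : f.natDegree < p - 1 := by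
    refine lt_of_le_of_lt (Polynomial.natDegree_sum_le_of_forall_le (n := p - 2) _ _ ?_) (by omega)
    intro k _
    refine (Polynomial.natDegree_monomial_le _).trans ?_
    omega
  have hf0 : f = 0 := by
    apply Polynomial.eq_zero_of_natDegree_lt_card_of_eval_eq_zero f
      (ι := (ZMod p)ˣ) (f := fun u => (u : ZMod p)) Units.val_injective
    · intro u
      rw [hf, Polynomial.eval_finsetSum]
      simpa using h u u.ne_zero
    · rw [ZMod.card_units]; exact hdeg
  intro k
  have : f.coeff k = c k := by
    rw [hf, Polynomial.finsetSum_coeff, Finset.sum_eq_single k]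
    · simp
    · intro b _ hb
      rw [Polynomial.coeff_monomial, if_neg]
      exact fun h => hb (Fin.ext h)
    · simp
  rw [← this, hf0, Polynomial.coeff_zero]

end poly

/-- Non-vanishing of the relevant binomial coefficient. -/
lemma choose_ne {p : ℕ} [hp : Fact p.Prime] {j s b : ℕ} (k : ℕ) (hj : j + 1 ≤ p)
    (hb : b + 1 = (j + 1) * p ^ s) :
    (((k + 1) * p ^ (s + 1) - 1).choose b : ZMod p) ≠ 0 := by
  have hp1 := hp.out.one_lt
  have shift : ∀ x t, 1 ≤ x → p * (x * p ^ t - 1) + (p - 1) = x * p ^ (t + 1) - 1 := by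
    intro x t hx
    have : 1 ≤ x * p ^ t := Nat.mul_pos hx (Nat.pow_pos (by omega))
    have e1 : x * p ^ (t + 1) = p * (x * p ^ t - 1) + p := by
      rw [← Nat.mul_succ, Nat.succ_eq_add_one, Nat.sub_add_cancel this]; ring
    omega
  obtain rfl : b = (j + 1) * p ^ s - 1 := by omega
  induction s with
  | zero =>
    have l := lucas_cast (p := p) (a0 := p - 1) (u0 := j) k 0 (by omega) (by omega)
    have e := shift (k + 1) 0 (by omega)
    simp only [pow_zero, mul_one, Nat.add_sub_cancel] at e ⊢
    rw [← e]
    simp only [mul_zero, zero_add, Nat.choose_zero_right, Nat.cast_one, mul_one] at l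
    rw [l, Ne, ZMod.natCast_eq_zero_iff]
    intro hd
    have := Nat.choose_mul_factorial_mul_factorial (show j ≤ p - 1 by omega)
    have h2 : p ∣ (p - 1).factorial := by
      rw [← this, mul_assoc]; exact hd.mul_right _
    rw [hp.out.dvd_factorial] at h2
    omega
  | succ s ih =>
    have l := lucas_cast (p := p) (a0 := p - 1) (u0 := p - 1) ((k + 1) * p ^ (s + 1) - 1)
      ((j + 1) * p ^ s - 1) (by omega) (by omega)
    rw [shift _ _ (by omega), shift _ _ (by omega)] at l
    rw [l]
    have : 0 < (j + 1) * p ^ s := Nat.mul_pos (by omega) (Nat.pow_pos (by omega))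
    simpa using ih (by omega)

/-- Crossley's Theorem 1.1, third case: for `m = ((i+1)p^r + j + 1)p^s - 2` with
`1 ≤ i ≤ p-1`, `0 ≤ j ≤ p-2`, `r ≥ 2`, `s ≥ 0`, the monomials of `basisSet10` lie in the
degree-`m` homogeneous part `V_m` and their images form a basis of `V_m/(V_m ∩ H)`: the
images mod the hit polynomials `H` are linearly independent, and every homogeneous
polynomial of degree `m` lies in `H ⊔ span(basisSet10)`. -/
theorem crossley_case3 (p : ℕ) (hp : p.Prime) (hodd : Odd p) (i j r s m : ℕ)
    (hi1 : 1 ≤ i) (hi2 : i ≤ p - 1) (hj : j ≤ p - 2) (hr : 2 ≤ r)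
    (hm : m = ((i + 1) * p ^ r + j + 1) * p ^ s - 2) :
    (∀ g ∈ basisSet10 p i j r s m, g.IsHomogeneous m) ∧
    LinearIndependent (ZMod p)
      (fun g : basisSet10 p i j r s m =>
        Submodule.Quotient.mk (p := Hit p 2) (g : MvPolynomial (Fin 2) (ZMod p))) ∧
    (∀ f : MvPolynomial (Fin 2) (ZMod p), f.IsHomogeneous m →
        f ∈ Hit p 2 ⊔ Submodule.span (ZMod p) (basisSet10 p i j r s m)) := by
  have : Fact p.Prime := ⟨hp⟩
  have hp1 := hp.one_lt
  have hps : 1 ≤ p ^ s := Nat.one_le_pow _ _ (by omega)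
  set a := (i + 1) * p ^ (r + s) - 1 with ha
  set b := (j + 1) * p ^ s - 1 with hb
  have ha1 : a + 1 = (i + 1) * p ^ (r + s) := by
    have : 0 < (i + 1) * p ^ (r + s) := Nat.mul_pos (by omega) (Nat.pow_pos (by omega))
    omega
  have hb1 : b + 1 = (j + 1) * p ^ s := by
    have : 0 < (j + 1) * p ^ s := Nat.mul_pos (by omega) (Nat.pow_pos (by omega))
    omega
  have hD : ((i + 1) * p ^ r + j + 1) * p ^ s = (a + 1) + (b + 1) := by
    rw [ha1, hb1, pow_add]; ring
  have hm2 : m + 2 = ((i + 1) * p ^ r + j + 1) * p ^ s := by omega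
  have hab : a + b = m := by omega
  have hbig : 2 * p ^ (s + 2) ≤ a + 1 := by
    rw [ha1]
    exact Nat.mul_le_mul (by omega) (Nat.pow_le_pow_right (by omega) (by omega))
  have hps2 : p ^ (s + 2) = p * p ^ (s + 1) := by rw [pow_succ]; ring
  have hps1 : p ^ (s + 1) = p * p ^ s := by rw [pow_succ]; ring
  have hpos1 : 1 ≤ p ^ (s + 1) := Nat.one_le_pow _ _ (by omega)
  have hb2 : b + 1 + p ^ s ≤ p ^ (s + 1) := by
    rw [hb1, hps1]
    calc (j + 1) * p ^ s + p ^ s = (j + 2) * p ^ s := by ring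
      _ ≤ p * p ^ s := Nat.mul_le_mul_right _ (by omega)
  have hba : b < a := by
    have : p ^ (s + 1) ≤ p ^ (s + 2) := Nat.pow_le_pow_right (by omega) (by omega)
    omega
  -- bounds for the middle exponents
  have hck : ∀ k, 1 ≤ k → k ≤ p - 1 → (k + 1) * p ^ (s + 1) ≤ p ^ (s + 2) := by
    intro k _ h2
    rw [hps2]; exact Nat.mul_le_mul_right _ (by omega)
  have hck' : ∀ k, 1 ≤ k → 2 * p ^ (s + 1) ≤ (k + 1) * p ^ (s + 1) := fun k h1 =>
    Nat.mul_le_mul_right _ (by omega)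
  refine ⟨?_, ?_, ?_⟩
  · have hom : ∀ x y, x + y = m →
        (X 0 ^ x * X 1 ^ y : MvPolynomial (Fin 2) (ZMod p)).IsHomogeneous m := by
      intro x y hxy
      rw [← hxy]
      exact (isHomogeneous_X_pow 0 x).mul (isHomogeneous_X_pow 1 y)
    rintro g (⟨k, hk1, hk2, rfl⟩ | rfl | rfl)
    · have := hck k hk1 hk2
      exact hom _ _ (by omega)
    · exact hom _ _ (by omega)
    · exact hom _ _ (by omega)
  · let v : Option (Option (Fin (p - 1))) → MvPolynomial (Fin 2) (ZMod p) := fun o =>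
      match o with
      | none => mon p b a
      | some none => mon p a b
      | some (some k) => mon p ((k + 2) * p ^ (s + 1) - 1) (m - ((k + 2) * p ^ (s + 1) - 1))
    have hv : LinearIndependent (ZMod p) (fun o => Submodule.Quotient.mk (p := Hit p 2) (v o)) := by
      rw [Fintype.linearIndependent_iff]
      intro c hc
      have hmem : ∑ o, c o • v o ∈ Hit p 2 := by
        rw [← Submodule.Quotient.mk_eq_zero, ← hc, ← Submodule.mkQ_apply, map_sum]
        simp
      have hmid : ∀ k : Fin (p - 1), p ^ (s + 1) ≤ (k + 2) * p ^ (s + 1) - 1 ∧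
          (k + 2) * p ^ (s + 1) - 1 < a ∧
          (k + 2) * p ^ (s + 1) - 1 + (m - ((k + 2) * p ^ (s + 1) - 1)) = m := by
        intro k
        have h1 := hck (k + 1) (by omega) (by omega)
        have h2 := hck' (k + 1) (by omega)
        rw [add_assoc, show 1 + 1 = 2 from rfl] at h1 h2
        omega
      have f1 : c none = 0 := by
        have := Lfun_hit (p := p) (a := b) (b := a) 0 (show 1 ≤ j + 1 by omega) (by omega)
          (show 1 ≤ i + 1 by omega) (by omega) hb1 ha1 hmem
        rw [map_sum, Fintype.sum_option, Fintype.sum_option, Finset.sum_eq_zero] at this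
        · simp only [v, map_smul] at this
          rw [Lfun_zero_mon rfl, Lfun_zero_mon (by omega), if_neg hba.ne'] at this
          simpa using this
        · intro k _
          obtain ⟨h1, h2, h3⟩ := hmid k
          simp only [v, map_smul]
          rw [Lfun_zero_mon (by omega), if_neg (by omega), smul_zero]
      have f2 : c (some none) = 0 := by
        have := Lfun_hit (p := p) (a := a) (b := b) 0 (show 1 ≤ i + 1 by omega) (by omega)
          (show 1 ≤ j + 1 by omega) (by omega) ha1 hb1 hmem
        rw [map_sum, Fintype.sum_option, Fintype.sum_option, Finset.sum_eq_zero] at this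
        · simp only [v, map_smul] at this
          rw [Lfun_zero_mon rfl, Lfun_zero_mon (by omega), if_neg hba.ne] at this
          simpa using this
        · intro k _
          obtain ⟨h1, h2, h3⟩ := hmid k
          simp only [v, map_smul]
          rw [Lfun_zero_mon (by omega), if_neg (by omega), smul_zero]
      -- the binomial coefficient at the middle exponents
      have hbin : ∀ k : Fin (p - 1), (((k + 2) * p ^ (s + 1) - 1).choose b : ZMod p) ≠ 0 := by
        intro k
        exact choose_ne (k + 1) (by omega) hb1
      have f3 : ∀ k : Fin (p - 1),
          c (some (some k)) * (((k + 2) * p ^ (s + 1) - 1).choose b : ZMod p) = 0 := by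
        apply vander
        intro l hl
        have := Lfun_hit (p := p) (a := b) (b := a) l (show 1 ≤ j + 1 by omega) (by omega)
          (show 1 ≤ i + 1 by omega) (by omega) hb1 ha1 hmem
        rw [map_sum, Fintype.sum_option, Fintype.sum_option, f1, f2] at this
        simp only [v, map_smul, zero_smul, map_zero, zero_add] at this
        have hl1 : l ^ (p - 1) = 1 := ZMod.pow_card_sub_one_eq_one hl
        have hpp : ∀ t x, l ^ (x * p ^ t) = l ^ x := by
          intro t x
          rw [pow_mul, ZMod.pow_card_pow]
        refine (mul_eq_zero_iff_right (pow_ne_zero 2 hl)).1 ?_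
        have e0 : l ^ (b + 1) = l ^ (j + 1) := by rw [hb1, hpp]
        have e1 : ∀ k : Fin (p - 1), l ^ ((k + 2) * p ^ (s + 1) - 1 - b) * l ^ (j + 1)
            = l ^ (k : ℕ) * l ^ 2 := by
          intro k
          obtain ⟨h1, h2, h3⟩ := hmid k
          rw [← e0, ← pow_add, ← pow_add, show (k + 2) * p ^ (s + 1) - 1 - b + (b + 1)
            = (k + 2) * p ^ (s + 1) by omega, hpp]
        rw [Finset.sum_mul]
        have := congrArg (· * l ^ (j + 1)) this
        simp only [zero_mul, Finset.sum_mul] at this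
        rw [← this]
        refine Finset.sum_congr rfl fun k _ => ?_
        obtain ⟨h1, h2, h3⟩ := hmid k
        rw [Lfun_mon _ (by omega), smul_eq_mul]
        linear_combination -(c (some (some k)) *
          (((k + 2) * p ^ (s + 1) - 1).choose b : ZMod p)) * e1 k
      rintro (_ | _ | k)
      · exact f1
      · exact f2
      · exact (mul_eq_zero.1 (f3 k)).resolve_right (hbin k)
    have hex : ∀ g : basisSet10 p i j r s m, ∃ o, v o = g := by
      rintro ⟨g, ⟨k, hk1, hk2, rfl⟩ | rfl | rfl⟩
      · refine ⟨some (some ⟨k - 1, by omega⟩), ?_⟩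
        simp only [v, show k - 1 + 2 = k + 1 by omega]
        rfl
      · exact ⟨none, rfl⟩
      · exact ⟨some none, rfl⟩
    choose σ hσ using hex
    have hinj : Function.Injective σ := by
      intro g g' h
      apply Subtype.ext
      rw [← hσ g, ← hσ g', h]
    have := hv.comp σ hinj
    have heq : (fun o => Submodule.Quotient.mk (p := Hit p 2) (v o)) ∘ σ =
        (fun g : basisSet10 p i j r s m =>
          Submodule.Quotient.mk (p := Hit p 2) (g : MvPolynomial (Fin 2) (ZMod p))) := by
      funext g
      simp only [Function.comp_apply, hσ]
    rw [heq] at this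
    exact this
  · intro f hf
    have hmon : ∀ n k, n + k = m →
        mon p n k ∈ Hit p 2 ⊔ Submodule.span (ZMod p) (basisSet10 p i j r s m) := by
      intro n k hnk
      by_contra hcon
      obtain ⟨φ, hφ, hle⟩ := Submodule.exists_le_ker_of_notMem hcon
      have hH : ∀ g ∈ Hit p 2, φ g = 0 := fun g hg => hle (Submodule.mem_sup_left hg)
      have hB : ∀ g ∈ basisSet10 p i j r s m, φ g = 0 := fun g hg =>
        hle (Submodule.mem_sup_right (Submodule.subset_span hg))
      have hgood : GoodSeq p m (fun n => φ (mon p n (m - n))) := by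
        intro k a b hk hab
        have := hH (steenrodP p 2 k (mon p a b)) (Submodule.subset_span ⟨k, hk, _, rfl⟩)
        rw [steenrod_mon, map_sum] at this
        rw [← this]
        refine Finset.sum_congr rfl fun uv huv => ?_
        rw [Finset.HasAntidiagonal.mem_antidiagonal] at huv
        have e1 : m - (a + uv.1 * (p - 1)) = b + uv.2 * (p - 1) := by
          rw [← hab, ← huv, add_mul]; omega
        simp only [map_smul, smul_eq_mul, e1]
      have := hgood.all (i := i) (j := j) (r := r) hi1 (by omega) hr s m _ hm2
        (fun k hk1 hk2 => hB _ (Or.inl ⟨k, hk1, hk2, rfl⟩))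
        (by rw [← hb, show m - b = a by omega]; exact hB _ (Or.inr (Or.inl rfl)))
        (by rw [← ha, show m - a = b by omega]; exact hB _ (Or.inr (Or.inr rfl)))
        n (by omega)
      rw [show m - n = k by omega] at this
      exact hφ this
    rw [f.as_sum]
    refine Submodule.sum_mem _ fun d hd => ?_
    have e1 : monomial d (coeff d f) = coeff d f • mon p (d 0) (d 1) := by
      rw [← exists_mon, smul_monomial, smul_eq_mul, mul_one]
    rw [e1]
    refine Submodule.smul_mem _ _ (hmon _ _ ?_)
    have := hf (mem_support_iff.1 hd)
    rw [Finsupp.weight_apply, Finsupp.sum_fintype] at this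
    · simpa using this
    · simp
end

section
/- Crossley's Theorem 1.1, fourth case: Let p be an odd prime and let m = (p^2 + ip + j + 1)p^s − 2 where 1 ≤ i ≤ j ≤ p−2 and s ≥ 0. Then the images of the monomials x^{(k+1)p^{s+1} − 1} y^{m − (k+1)p^{s+1} + 1} for i ≤ k ≤ j form an 𝔽_p-basis of the quotient vector space V_m / (V_m ∩ H), where V_m ⊆ P_2 = 𝔽_p[x,y] is the subspace of homogeneous polynomials of total degree m and H ⊆ P_2 is the subspace of hit polynomials. -/
open MvPolynomial

/-- Crossley's monomial set for degree `m = (p² + ip + j + 1)p^s - 2`: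
`{x^{(k+1)p^{s+1}-1} y^{m-(k+1)p^{s+1}+1} : i ≤ k ≤ j}`. -/
noncomputable def basisSet11 (p i j s m : ℕ) : Set (MvPolynomial (Fin 2) (ZMod p)) :=
  {g | ∃ k, i ≤ k ∧ k ≤ j ∧
      g = X 0 ^ ((k + 1) * p ^ (s + 1) - 1) * X 1 ^ (m - ((k + 1) * p ^ (s + 1) - 1))}


lemma cz_lucas (p : ℕ) [Fact p.Prime] (a b u v : ℕ) (hb : b < p) (hv : v < p) :
    (((a * p + b).choose (u * p + v) : ℕ) : ZMod p) = (b.choose v : ZMod p) * (a.choose u : ZMod p) := by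
  have h := Choose.choose_modEq_choose_mod_mul_choose_div_nat (n := a * p + b) (k := u * p + v) (p := p)
  have hp : 0 < p := (Fact.out : p.Prime).pos
  have e1 : (a * p + b) % p = b := by rw [Nat.mul_add_mod_self_right, Nat.mod_eq_of_lt hb]
  have e2 : (u * p + v) % p = v := by rw [Nat.mul_add_mod_self_right, Nat.mod_eq_of_lt hv]
  have e3 : (a * p + b) / p = a := by
    rw [mul_comm, Nat.mul_add_div hp, Nat.div_eq_of_lt hb, add_zero]
  have e4 : (u * p + v) / p = u := by
    rw [mul_comm, Nat.mul_add_div hp, Nat.div_eq_of_lt hv, add_zero]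
  rw [e1, e2, e3, e4] at h
  have := (ZMod.natCast_eq_natCast_iff _ _ _).2 h
  push_cast at this
  exact this

/-- `C(p-1-d, u) = (-1)^u C(d+u, u)` mod `p`, for `d + u ≤ p - 1`. -/
lemma cz_neg (p : ℕ) [Fact p.Prime] (d u w : ℕ) (h : w + 1 + d = p) (hu : u ≤ w) :
    ((w.choose u : ℕ) : ZMod p) = (-1) ^ u * ((d + u).choose u : ZMod p) := by
  induction u with
  | zero => simp
  | succ u ih =>
    have ih := ih (by omega)
    have h1 := congrArg (Nat.cast (R := ZMod p)) (Nat.choose_succ_right_eq w u)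
    have h2 := congrArg (Nat.cast (R := ZMod p)) (Nat.add_one_mul_choose_eq (d + u) u)
    have h3 : ((w - u : ℕ) : ZMod p) = -((d : ZMod p) + u + 1) := by
      have : (((w - u) + (d + u + 1) : ℕ) : ZMod p) = 0 := by
        rw [show (w - u) + (d + u + 1) = p by omega]; simp
      push_cast at this
      linear_combination this
    have h4 : ((u : ZMod p) + 1) ≠ 0 := by
      have : ((u + 1 : ℕ) : ZMod p) ≠ 0 := by
        rw [Ne, ZMod.natCast_eq_zero_iff]
        intro hd
        have := Nat.le_of_dvd (by omega) hd
        omega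
      simpa using this
    push_cast at h1 h2
    rw [h3, ih] at h1
    apply mul_right_cancel₀ h4
    rw [h1, show d + (u + 1) = d + u + 1 by ring]
    linear_combination (-1 : ZMod p) ^ (u + 1) * h2

/-- base case of the binomial computation -/
lemma cz_base (p : ℕ) [Fact p.Prime] (K t e u : ℕ) (hKt : K + t ≤ p) (ht : t < p)
    (h : e + 1 + u * (p - 1) = K * p + (p - 1) * t) :
    ((e.choose u : ℕ) : ZMod p) = (-1) ^ u * (t.choose u : ZMod p) := by
  have hp : 2 ≤ p := (Fact.out : p.Prime).two_le
  obtain ⟨P, rfl⟩ : ∃ P, p = P + 1 := ⟨p - 1, by omega⟩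
  simp only [Nat.add_sub_cancel] at h
  by_cases heu : e < u
  · rw [Nat.choose_eq_zero_of_lt heu]
    by_cases hut : t < u
    · rw [Nat.choose_eq_zero_of_lt hut]; simp
    · exfalso
      obtain ⟨q, rfl⟩ : ∃ q, t = u + q := ⟨t - u, by omega⟩
      have : e + 1 = K * (P + 1) + P * q := by nlinarith
      have hKq : K ≠ 0 ∨ q ≠ 0 := by
        by_contra hh
        push Not at hh
        rw [hh.1, hh.2] at this; simp at this
      have : P ≤ e + 1 := by
        rw [this]
        rcases hKq with h | h
        · have := Nat.mul_le_mul_right (P + 1) (Nat.one_le_iff_ne_zero.2 h); nlinarith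
        · have := Nat.mul_le_mul_left P (Nat.one_le_iff_ne_zero.2 h); nlinarith
      rcases Nat.eq_zero_or_pos q with h0 | h0
      · subst h0
        have h1 := Nat.mul_le_mul_right (P + 1) (show 1 ≤ K by omega); nlinarith
      · omega
  · have hup : u < P + 1 := by
      by_contra hc
      have h1 : u * (P + 1) ≤ e + u * P := by nlinarith
      have h2 : K * (P + 1) + P * t = (K + t) * (P + 1) - t := by
        rw [eq_comm, Nat.sub_eq_iff_eq_add (by nlinarith)]; ring
      have h3 : (K + t) * (P + 1) ≤ (P + 1) * (P + 1) := Nat.mul_le_mul_right _ hKt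
      have h4 : (P + 1) * (P + 1) ≤ u * (P + 1) := Nat.mul_le_mul_right _ (by omega)
      nlinarith
    by_cases hut : u ≤ t
    · obtain ⟨q, rfl⟩ : ∃ q, t = u + q := ⟨t - u, by omega⟩
      have h1 : e + 1 = (K + q) * (P + 1) - q := by
        rw [eq_comm, Nat.sub_eq_iff_eq_add (by nlinarith)]; nlinarith
      have hKq : K + q ≠ 0 := by
        intro h0
        rw [h0] at h1; simp at h1
      obtain ⟨A, hA⟩ : ∃ A, K + q = A + 1 := ⟨K + q - 1, by omega⟩
      have he : e = A * (P + 1) + (P - q) := by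
        rw [hA] at h1
        have : (A + 1) * (P + 1) = A * (P + 1) + (P + 1) := by ring
        omega
      have := cz_lucas (P + 1) A (P - q) 0 u (by omega) (by omega)
      rw [zero_mul, zero_add] at this
      rw [he, this, cz_neg (P + 1) q u (P - q) (by omega) (by omega), add_comm u q]
      simp
    · obtain ⟨q, rfl⟩ : ∃ q, u = t + 1 + q := ⟨u - t - 1, by omega⟩
      have h1 : e + (q + 1) * P + 1 = K * (P + 1) := by nlinarith
      have h2 : q + 1 ≤ K := by
        by_contra hc
        have := Nat.mul_le_mul_right (P + 1) (show K ≤ q by omega)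
        nlinarith
      obtain ⟨A, hA⟩ : ∃ A, K = q + 1 + A := ⟨K - (q + 1), by omega⟩
      have he : e = A * (P + 1) + q := by subst hA; nlinarith
      have := cz_lucas (P + 1) A q 0 (t + 1 + q) (by omega) (by omega)
      rw [zero_mul, zero_add] at this
      rw [he, this, Nat.choose_eq_zero_of_lt (show q < t + 1 + q by omega),
        Nat.choose_eq_zero_of_lt (show t < t + 1 + q by omega)]
      simp

lemma cz_step (p : ℕ) [Fact p.Prime] (a e u : ℕ)
    (h : e + 1 + u * (p - 1) = p * a) (hne : ((e.choose u : ℕ) : ZMod p) ≠ 0) :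
    ∃ e' u', e = e' * p + (p - 1) ∧ u = u' * p ∧ e' + 1 + u' * (p - 1) = a ∧
      ((e.choose u : ℕ) : ZMod p) = (e'.choose u' : ZMod p) := by
  have hp : 2 ≤ p := (Fact.out : p.Prime).two_le
  obtain ⟨P, rfl⟩ : ∃ P, p = P + 1 := ⟨p - 1, by omega⟩
  simp only [Nat.add_sub_cancel] at h ⊢
  have hu := Nat.div_add_mod u (P + 1)
  have hul := Nat.mod_lt u (show P + 1 > 0 by omega)
  set u1 := u / (P + 1)
  set u0 := u % (P + 1)
  have hu' : u = u1 * (P + 1) + u0 := by linarith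
  have key : e + 1 + u * (P + 1) = (P + 1) * a + u := by linarith
  rcases Nat.eq_zero_or_pos u0 with h0 | h0
  · rw [h0, add_zero] at hu'
    have hd : (P + 1) ∣ e + 1 := by
      have h1 : (P + 1) ∣ e + 1 + u * (P + 1) := by
        rw [key, hu']; exact ⟨a + u1, by ring⟩
      exact (Nat.dvd_add_left (Dvd.intro_left u rfl)).1 h1
    obtain ⟨c, hc⟩ := hd
    have hc0 : c ≠ 0 := by rintro rfl; simp at hc
    obtain ⟨e', rfl⟩ : ∃ e', c = e' + 1 := ⟨c - 1, by omega⟩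
    have he : e = e' * (P + 1) + P := by linarith
    refine ⟨e', u1, he, hu', ?_, ?_⟩
    · have : (P + 1) * (e' + 1 + u1 * P) = (P + 1) * a := by
        rw [← h, he, hu']; ring
      exact Nat.eq_of_mul_eq_mul_left (by omega) this
    · have := cz_lucas (P + 1) e' P u1 0 (by omega) (by omega)
      rw [add_zero] at this
      rw [he, hu', this]; simp
  · exfalso
    apply hne
    have hmod : e % (P + 1) = u0 - 1 := by
      have h1 : (e + 1) % (P + 1) = u0 := by
        have h2 := congrArg (· % (P + 1)) key
        simp only [Nat.add_mul_mod_self_right, Nat.mul_add_mod_self_left] at h2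
        exact h2
      have h3 := Nat.div_add_mod (e + 1) (P + 1)
      rw [h1] at h3
      have h4 : e = (P + 1) * ((e + 1) / (P + 1)) + (u0 - 1) := by omega
      rw [h4, Nat.mul_add_mod_self_left, Nat.mod_eq_of_lt (by omega)]
    have he := Nat.div_add_mod e (P + 1)
    rw [hmod] at he
    have := cz_lucas (P + 1) (e / (P + 1)) (u0 - 1) u1 u0 (by omega) (by omega)
    rw [show e / (P + 1) * (P + 1) + (u0 - 1) = e by linarith, ← hu',
      Nat.choose_eq_zero_of_lt (show u0 - 1 < u0 by omega)] at this
    rw [this]; simp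

/-- vanishing part -/
lemma cz_gen (p : ℕ) [Fact p.Prime] (s K t e u : ℕ) (hKt : K + t ≤ p) (ht : t < p)
    (h : e + 1 + u * (p - 1) = p ^ s * (K * p + (p - 1) * t))
    (hne : ((e.choose u : ℕ) : ZMod p) ≠ 0) :
    ∃ u' q, t = u' + q ∧ u = p ^ s * u' ∧ e + 1 = p ^ s * (K * p + (p - 1) * q) := by
  induction s generalizing e u with
  | zero =>
    have h1 := cz_base p K t e u hKt ht (by simpa using h)
    have hut : u ≤ t := by
      by_contra hc
      rw [Nat.choose_eq_zero_of_lt (show t < u by omega)] at h1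
      exact hne (by rw [h1]; simp)
    refine ⟨u, t - u, by omega, by simp, ?_⟩
    obtain ⟨q, rfl⟩ : ∃ q, t = u + q := ⟨t - u, by omega⟩
    simp only [pow_zero, one_mul, Nat.add_sub_cancel_left] at h ⊢
    linarith
  | succ s ih =>
    obtain ⟨e', u', he, hu, h', hc⟩ := cz_step p (p ^ s * (K * p + (p - 1) * t)) e u
      (by rw [h]; ring) hne
    obtain ⟨u'', q, h1, h2, h3⟩ := ih e' u' h' (hc ▸ hne)
    refine ⟨u'', q, h1, by rw [hu, h2]; ring, ?_⟩
    have hp : 2 ≤ p := (Fact.out : p.Prime).two_le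
    have : e + 1 = p * (e' + 1) := by rw [he]; obtain ⟨P, rfl⟩ : ∃ P, p = P + 1 := ⟨p - 1, by omega⟩; simp; ring
    rw [this, h3]; ring

/-- value part -/
lemma cz_val (p : ℕ) [Fact p.Prime] (s K u q e : ℕ) (hKt : K + (u + q) ≤ p) (ht : u + q < p)
    (h : e + 1 = p ^ s * (K * p + (p - 1) * q)) :
    ((e.choose (p ^ s * u) : ℕ) : ZMod p) = (-1) ^ u * ((u + q).choose q : ZMod p) := by
  induction s generalizing e with
  | zero =>
    have h1 := cz_base p K (u + q) e u hKt ht (by simp at h; rw [h]; ring)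
    simp only [pow_zero, one_mul]
    rw [h1, Nat.choose_symm_add]
  | succ s ih =>
    have hp : 2 ≤ p := (Fact.out : p.Prime).two_le
    have hd : p ∣ e + 1 := ⟨p ^ s * (K * p + (p - 1) * q), by rw [h]; ring⟩
    obtain ⟨c, hc⟩ := hd
    have hc0 : c ≠ 0 := by rintro rfl; simp at hc
    obtain ⟨e', rfl⟩ : ∃ e', c = e' + 1 := ⟨c - 1, by omega⟩
    have he' : e' + 1 = p ^ s * (K * p + (p - 1) * q) := by
      apply Nat.eq_of_mul_eq_mul_left (show 0 < p by omega)
      rw [← hc, h]; ring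
    have he : e = e' * p + (p - 1) := by
      have : p * (e' + 1) = e' * p + p := by ring
      omega
    rw [← ih e' he']
    have := cz_lucas p e' (p - 1) (p ^ s * u) 0 (by omega) (by omega)
    rw [he, show p ^ (s + 1) * u = p ^ s * u * p + 0 by ring, this]
    simp

/-- alternating sum -/
lemma cz_alt (n q q' : ℕ) (h : q + q' < n) :
    ∑ t ∈ Finset.range (n + 1), ((-1 : ℤ) ^ t * n.choose t * (t.choose q * (n - t).choose q')) = 0 := by
  obtain ⟨R, rfl⟩ : ∃ R, n = R + q' + q := ⟨n - q - q', by omega⟩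
  have hR : R ≠ 0 := by omega
  rw [show R + q' + q + 1 = q + (R + q' + 1) by ring, Finset.sum_range_add]
  rw [Finset.sum_eq_zero (s := Finset.range q)]
  · rw [show R + q' + 1 = (R + 1) + q' by ring, Finset.sum_range_add, zero_add]
    rw [Finset.sum_eq_zero (s := Finset.range q'), add_zero]
    · have h1 := Int.alternating_sum_range_choose_of_ne hR
      rw [← mul_zero (((-1 : ℤ) ^ q * (R + q' + q).choose q * (R + q').choose q')), ← h1,
        Finset.mul_sum]
      apply Finset.sum_congr rfl
      intro t ht
      have ht' : t ≤ R := by simp at ht; omega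
      have e1 := Nat.choose_mul (n := R + q' + q) (k := q + t) (s := q) (by omega)
      rw [show R + q' + q - q = R + q' by omega, show q + t - q = t by omega] at e1
      have e2 : (R + q').choose t * (R + q' - t).choose q' = (R + q').choose q' * R.choose t := by
        have a1 := Nat.choose_mul (n := R + q') (k := q' + t) (s := t) (by omega)
        have a2 := Nat.choose_mul (n := R + q') (k := q' + t) (s := q') (by omega)
        rw [show q' + t - t = q' by omega] at a1
        rw [show q' + t - q' = t by omega, show R + q' - q' = R by omega] at a2
        rw [← a1, ← a2, Nat.choose_symm_add]
      rw [show R + q' + q - (q + t) = R + q' - t by omega]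
      zify at e1 e2
      rw [pow_add]
      linear_combination (-1 : ℤ) ^ q * (-1) ^ t * ((R + q' - t).choose q' : ℤ) * e1
        + (-1 : ℤ) ^ q * (-1) ^ t * ((R + q' + q).choose q : ℤ) * e2
    · intro t ht
      have : (R + q' + q - (q + (R + 1 + t))).choose q' = 0 := by
        apply Nat.choose_eq_zero_of_lt
        simp at ht; omega
      rw [this]; simp
  · intro t ht
    have : t.choose q = 0 := Nat.choose_eq_zero_of_lt (by simpa using ht)
    rw [this]; simp

lemma cz_match (Q P A E q t x : ℕ) (hP : 0 < P) (h : E = Q * (A + P * q)) :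
    E + x * P = Q * (A + P * t) ↔ x + Q * q = Q * t := by
  subst h
  have e1 : Q * (A + P * q) + x * P = (x + Q * q) * P + Q * A := by ring
  have e2 : Q * (A + P * t) = (Q * t) * P + Q * A := by ring
  rw [e1, e2]
  constructor
  · intro h
    exact Nat.eq_of_mul_eq_mul_right hP (Nat.add_right_cancel h)
  · intro h; rw [h]

lemma cz_kill (p : ℕ) [Fact p.Prime] (s K L n e f r : ℕ) (hK : K + n ≤ p) (hL : L + n ≤ p)
    (hn : n < p) (hr : 1 ≤ r) :
    ∑ t ∈ Finset.range (n + 1), ((-1 : ZMod p) ^ t * n.choose t *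
      ∑ uv ∈ Finset.HasAntidiagonal.antidiagonal r,
        if e + 1 + uv.1 * (p - 1) = p ^ s * (K * p + (p - 1) * t) ∧
          f + 1 + uv.2 * (p - 1) = p ^ s * (L * p + (p - 1) * (n - t)) then
          ((e.choose uv.1 : ℕ) : ZMod p) * ((f.choose uv.2 : ℕ) : ZMod p) else 0) = 0 := by
  have hp : 2 ≤ p := (Fact.out : p.Prime).two_le
  have hps : 0 < p ^ s := by positivity
  by_contra hne
  obtain ⟨t0, ht0, h0⟩ := Finset.exists_ne_zero_of_sum_ne_zero hne
  obtain ⟨⟨u0, v0⟩, huv, h1⟩ := Finset.exists_ne_zero_of_sum_ne_zero (right_ne_zero_of_mul h0)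
  simp only [ne_eq, ite_eq_right_iff, mul_eq_zero, not_or, Classical.not_imp] at h1
  obtain ⟨⟨ha, hb⟩, hc1, hc2⟩ := h1
  simp only [Finset.HasAntidiagonal.mem_antidiagonal] at huv
  simp only [Finset.mem_range] at ht0
  obtain ⟨u, q, g1, g2, g3⟩ := cz_gen p s K t0 e u0 (by omega) (by omega) ha hc1
  obtain ⟨v, q', g1', g2', g3'⟩ := cz_gen p s L (n - t0) f v0 (by omega) (by omega) hb hc2
  have hR : r = p ^ s * (u + v) := by rw [← huv, g2, g2']; ring
  have huv1 : 1 ≤ u + v := by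
    by_contra hc
    rw [show u + v = 0 by omega] at hR
    simp at hR; omega
  have hqq : q + q' + (u + v) = n := by omega
  apply hne
  have inner : ∀ t ∈ Finset.range (n + 1), (∑ uv ∈ Finset.HasAntidiagonal.antidiagonal r,
        if e + 1 + uv.1 * (p - 1) = p ^ s * (K * p + (p - 1) * t) ∧
          f + 1 + uv.2 * (p - 1) = p ^ s * (L * p + (p - 1) * (n - t)) then
          ((e.choose uv.1 : ℕ) : ZMod p) * ((f.choose uv.2 : ℕ) : ZMod p) else 0)
        = (-1) ^ (u + v) * ((t.choose q : ZMod p) * ((n - t).choose q' : ZMod p)) := by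
    intro t ht
    simp only [Finset.mem_range] at ht
    have m1 : ∀ x, e + 1 + x * (p - 1) = p ^ s * (K * p + (p - 1) * t) ↔
        x + p ^ s * q = p ^ s * t := fun x => cz_match _ _ _ _ _ _ _ (by omega) g3
    have m2 : ∀ x, f + 1 + x * (p - 1) = p ^ s * (L * p + (p - 1) * (n - t)) ↔
        x + p ^ s * q' = p ^ s * (n - t) := fun x => cz_match _ _ _ _ _ _ _ (by omega) g3'
    simp only [m1, m2]
    by_cases hcase : q ≤ t ∧ q' ≤ n - t
    · obtain ⟨c1, c2⟩ := hcase
      obtain ⟨x, hx⟩ : ∃ x, t = x + q := ⟨t - q, by omega⟩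
      obtain ⟨y, hy⟩ : ∃ y, n - t = y + q' := ⟨n - t - q', by omega⟩
      have hxy : x + y = u + v := by omega
      rw [Finset.sum_eq_single (p ^ s * x, p ^ s * y)]
      · rw [if_pos ⟨by simp only; rw [hx]; ring, by simp only; rw [hy]; ring⟩]
        simp only
        rw [cz_val p s K x q e (by omega) (by omega) g3,
          cz_val p s L y q' f (by omega) (by omega) g3', hy, hx, ← hxy]
        ring
      · rintro ⟨a, b⟩ _ hab
        rw [if_neg]
        rintro ⟨z1, z2⟩
        apply hab
        simp only at z1 z2
        rw [hx, mul_add] at z1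
        rw [hy, mul_add] at z2
        ext <;> simp only <;> omega
      · intro hh
        exfalso; apply hh
        rw [Finset.HasAntidiagonal.mem_antidiagonal, hR, ← hxy]; ring
    · rw [Finset.sum_eq_zero]
      · rcases Nat.lt_or_ge t q with h | h
        · rw [Nat.choose_eq_zero_of_lt h]; simp
        · rw [Nat.choose_eq_zero_of_lt (show n - t < q' by omega)]; simp
      · rintro ⟨a, b⟩ _
        rw [if_neg]
        rintro ⟨z1, z2⟩
        apply hcase
        simp only at z1 z2
        constructor
        · exact Nat.le_of_mul_le_mul_left (by omega : p ^ s * q ≤ p ^ s * t) hps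
        · exact Nat.le_of_mul_le_mul_left (by omega : p ^ s * q' ≤ p ^ s * (n - t)) hps
  rw [Finset.sum_congr rfl (fun t ht => by rw [inner t ht])]
  have := congrArg (Int.cast (R := ZMod p)) (cz_alt n q q' (by omega))
  push_cast at this
  rw [← mul_zero ((-1 : ZMod p) ^ (u + v)), ← this, Finset.mul_sum]
  apply Finset.sum_congr rfl
  intro t _
  ring

lemma cz_coeff {R : Type*} [CommRing R] (a b : R) (e u : ℕ) :
    ((Polynomial.C a + Polynomial.C b * Polynomial.X) ^ e).coeff u =
      (e.choose u : R) * (a ^ (e - u) * b ^ u) := by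
  rw [add_comm, add_pow, Polynomial.finsetSum_coeff]
  have : ∀ k ∈ Finset.range (e + 1), (((Polynomial.C b * Polynomial.X) ^ k *
      (Polynomial.C a) ^ (e - k) * ((e.choose k : ℕ) : Polynomial R)).coeff u) =
      if k = u then (e.choose u : R) * (a ^ (e - u) * b ^ u) else 0 := by
    intro k _
    rw [mul_pow, ← Polynomial.C_pow, ← Polynomial.C_pow, ← Polynomial.C_eq_natCast,
      show Polynomial.C (b ^ k) * Polynomial.X ^ k * Polynomial.C (a ^ (e - k)) *
        Polynomial.C ((e.choose k : ℕ) : R) =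
        Polynomial.C (b ^ k * a ^ (e - k) * ((e.choose k : ℕ) : R)) * Polynomial.X ^ k by
          simp only [Polynomial.C_mul]; ring, Polynomial.coeff_C_mul_X_pow]
    by_cases h : u = k
    · subst h; simp; ring
    · rw [if_neg h, if_neg (Ne.symm h)]
  rw [Finset.sum_congr rfl this, Finset.sum_ite_eq']
  split_ifs with h
  · rfl
  · rw [Nat.choose_eq_zero_of_lt (by simp at h; omega)]; simp

lemma cz_mono (p : ℕ) [Fact p.Prime] (e f r : ℕ) :
    steenrodP p 2 r (X 0 ^ e * X 1 ^ f) = ∑ uv ∈ Finset.HasAntidiagonal.antidiagonal r,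
      (((e.choose uv.1 : ℕ) : ZMod p) * ((f.choose uv.2 : ℕ) : ZMod p)) •
        (X 0 ^ (e + uv.1 * (p - 1)) * X 1 ^ (f + uv.2 * (p - 1)) :
          MvPolynomial (Fin 2) (ZMod p)) := by
  have hp : 2 ≤ p := (Fact.out : p.Prime).two_le
  unfold steenrodP Phi
  rw [map_mul, map_pow, map_pow, aeval_X, aeval_X, Polynomial.coeff_mul]
  apply Finset.sum_congr rfl
  rintro ⟨u, v⟩ _
  simp only
  rw [cz_coeff, cz_coeff]
  have key : ∀ (i : Fin 2) (e u : ℕ), ((e.choose u : ℕ) : MvPolynomial (Fin 2) (ZMod p)) *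
      ((X i) ^ (e - u) * ((X i) ^ p) ^ u) =
      C ((e.choose u : ℕ) : ZMod p) * (X i) ^ (e + u * (p - 1)) := by
    intro i e u
    rcases Nat.lt_or_ge e u with h | h
    · rw [Nat.choose_eq_zero_of_lt h]; simp
    · rw [← pow_mul, ← pow_add]
      have hexp : e - u + p * u = e + u * (p - 1) := by
        obtain ⟨P, rfl⟩ : ∃ P, p = P + 1 := ⟨p - 1, by omega⟩
        obtain ⟨d, rfl⟩ : ∃ d, e = u + d := ⟨e - u, by omega⟩
        simp only [Nat.add_sub_cancel_left, Nat.add_sub_cancel]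
        ring
      rw [hexp, map_natCast]
  rw [key, key, smul_eq_C_mul, C_mul]
  ring

lemma cz_coeffXX (p A B a b : ℕ) :
    coeff (Finsupp.single 0 a + Finsupp.single 1 b)
      (X 0 ^ A * X 1 ^ B : MvPolynomial (Fin 2) (ZMod p)) = if A = a ∧ B = b then 1 else 0 := by
  rw [X_pow_eq_monomial, X_pow_eq_monomial, monomial_mul, coeff_monomial]
  congr 1
  · rw [eq_iff_iff]
    constructor
    · intro h
      have h0 := DFunLike.congr_fun h 0
      have h1 := DFunLike.congr_fun h 1
      simp at h0 h1
      exact ⟨h0, h1⟩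
    · rintro ⟨rfl, rfl⟩; rfl
  · simp

/-- The functional detecting a basis element. -/
noncomputable def czLam (p s K L n : ℕ) : MvPolynomial (Fin 2) (ZMod p) →ₗ[ZMod p] ZMod p :=
  ∑ t ∈ Finset.range (n + 1), ((-1 : ZMod p) ^ t * n.choose t) •
    (lcoeff (ZMod p) (Finsupp.single 0 (p ^ s * (K * p + (p - 1) * t) - 1) +
      Finsupp.single 1 (p ^ s * (L * p + (p - 1) * (n - t)) - 1)))

lemma czLam_apply (p s K L n : ℕ) [Fact p.Prime] (hK : 1 ≤ K) (hL : 1 ≤ L) (A B : ℕ) :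
    czLam p s K L n (X 0 ^ A * X 1 ^ B) = ∑ t ∈ Finset.range (n + 1),
      ((-1 : ZMod p) ^ t * n.choose t) * if A + 1 = p ^ s * (K * p + (p - 1) * t) ∧
        B + 1 = p ^ s * (L * p + (p - 1) * (n - t)) then 1 else 0 := by
  have hp : 2 ≤ p := (Fact.out : p.Prime).two_le
  unfold czLam
  rw [LinearMap.sum_apply]
  apply Finset.sum_congr rfl
  intro t _
  rw [LinearMap.smul_apply, lcoeff_apply, cz_coeffXX, smul_eq_mul]
  have h1 : 1 ≤ p ^ s * (K * p + (p - 1) * t) := Nat.mul_pos (by positivity) (by positivity)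
  have h2 : 1 ≤ p ^ s * (L * p + (p - 1) * (n - t)) := Nat.mul_pos (by positivity) (by positivity)
  congr 2
  rw [eq_iff_iff]
  constructor <;> rintro ⟨_, _⟩ <;> constructor <;> omega

lemma cz_asum (p : ℕ) (g : MvPolynomial (Fin 2) (ZMod p)) :
    g = ∑ d ∈ g.support, coeff d g • (X 0 ^ (d 0) * X 1 ^ (d 1)) := by
  conv_lhs => rw [g.as_sum]
  apply Finset.sum_congr rfl
  intro d _
  rw [monomial_eq, smul_eq_C_mul]
  congr 1
  rw [Finsupp.prod_fintype _ _ (by simp)]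
  simp

lemma cz_steen_add (p r : ℕ) : ∃ T : MvPolynomial (Fin 2) (ZMod p) →ₗ[ZMod p]
    MvPolynomial (Fin 2) (ZMod p), ∀ g, T g = steenrodP p 2 r g := by
  refine ⟨⟨⟨fun g => steenrodP p 2 r g, ?_⟩, ?_⟩, fun g => rfl⟩
  · intro x y; simp [steenrodP]
  · intro c x; simp [steenrodP]

lemma czLam_hit (p s K L n : ℕ) [Fact p.Prime] (hK : 1 ≤ K) (hL : 1 ≤ L) (hK' : K + n ≤ p)
    (hL' : L + n ≤ p) (hn : n < p) : Hit p 2 ≤ LinearMap.ker (czLam p s K L n) := by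
  unfold Hit
  rw [Submodule.span_le]
  rintro _ ⟨r, hr, u, rfl⟩
  rw [SetLike.mem_coe, LinearMap.mem_ker]
  obtain ⟨T, hT⟩ := cz_steen_add p r
  rw [← hT, cz_asum p u, map_sum, map_sum]
  apply Finset.sum_eq_zero
  intro d _
  rw [map_smul, map_smul, hT, cz_mono, map_sum]
  rw [show (∑ x ∈ Finset.HasAntidiagonal.antidiagonal r, (czLam p s K L n)
      ((((d 0).choose x.1 : ZMod p) * ((d 1).choose x.2 : ZMod p)) •
        (X 0 ^ (d 0 + x.1 * (p - 1)) * X 1 ^ (d 1 + x.2 * (p - 1))))) = 0 from ?_, smul_zero]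
  rw [← cz_kill p s K L n (d 0) (d 1) r hK' hL' hn hr]
  simp only [map_smul, czLam_apply p s K L n hK hL, smul_eq_mul, Finset.mul_sum]
  rw [Finset.sum_comm]
  apply Finset.sum_congr rfl
  intro t _
  apply Finset.sum_congr rfl
  rintro ⟨a, b⟩ _
  simp only [mul_ite, mul_one, mul_zero, add_right_comm (d 0) _ 1, add_right_comm (d 1) _ 1]
  split_ifs
  · ring
  · rfl

/-- The relations satisfied by the values on monomials of a functional killing hit elements. -/
def czRel (p N : ℕ) (c : ℕ → ZMod p) : Prop :=
  ∀ r e f, 1 ≤ r → e + f + 2 + r * (p - 1) = N →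
    ∑ uv ∈ Finset.HasAntidiagonal.antidiagonal r,
      ((e.choose uv.1 : ℕ) : ZMod p) * ((f.choose uv.2 : ℕ) : ZMod p) *
        c (e + 1 + uv.1 * (p - 1)) = 0

lemma cz_sub_ne (p a b : ℕ) (ha : a < p) (hb : b < p) (h : a ≠ b) :
    (a : ZMod p) - (b : ZMod p) ≠ 0 := by
  rw [Ne, sub_eq_zero]
  intro hh
  have := (ZMod.natCast_eq_natCast_iff' _ _ _).1 hh
  rw [Nat.mod_eq_of_lt ha, Nat.mod_eq_of_lt hb] at this
  exact h this

lemma cz_nat_ne (p a : ℕ) (ha : a < p) (h : a ≠ 0) : (a : ZMod p) ≠ 0 := by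
  have := cz_sub_ne p a 0 ha (by omega) h
  simpa using this

lemma cz_one (p M n : ℕ) [Fact p.Prime] (c : ℕ → ZMod p) (hc : czRel p (M * p - n) c)
    (q t : ℕ) (hq : 1 ≤ q) (ht : t + 1 ≤ p) (h : q * p + p + n ≤ M * p + t) :
    ((t : ZMod p) + 1) * c ((q + 1) * p - (t + 1)) = ((t : ZMod p) - n) * c (q * p - t) := by
  have hp : 2 ≤ p := (Fact.out : p.Prime).two_le
  have hqp : p ≤ q * p := Nat.le_mul_of_pos_left p hq
  obtain ⟨e, he⟩ : ∃ e, q * p = e + t + 1 := ⟨q * p - t - 1, by omega⟩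
  obtain ⟨f, hf⟩ : ∃ f, M * p + t = q * p + p + n + f := ⟨M * p + t - (q * p + p + n), by omega⟩
  have h1 := hc 1 e f le_rfl (by omega)
  rw [Finset.Nat.sum_antidiagonal_eq_sum_range_succ_mk, Finset.sum_range_succ,
    Finset.sum_range_one] at h1
  simp only [Nat.choose_zero_right, Nat.sub_zero, Nat.choose_one_right, Nat.sub_self, zero_mul,
    add_zero, one_mul, Nat.cast_one, mul_one] at h1
  have e1 : (q + 1) * p - (t + 1) = e + 1 + (p - 1) := by
    rw [add_mul, one_mul]; omega
  have e2 : q * p - t = e + 1 := by omega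
  rw [e1, e2]
  have c1 := congrArg (Nat.cast (R := ZMod p)) he
  have c2 := congrArg (Nat.cast (R := ZMod p)) hf
  push_cast at c1 c2
  simp only [CharP.cast_eq_zero, mul_zero] at c1 c2
  have hfc : (f : ZMod p) = t - n := by linear_combination -c2
  have hec : (e : ZMod p) = -(t + 1) := by linear_combination -c1
  rw [hfc, hec] at h1
  linear_combination -h1

lemma cz_van (p M n : ℕ) [Fact p.Prime] (c : ℕ → ZMod p) (hc : czRel p (M * p - n) c)
    (hn : n + 2 ≤ p) (hM : p ≤ M) (q t : ℕ) (hq : 1 ≤ q) (hqM : q ≤ M) (ht : n + 1 ≤ t)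
    (htp : t + 1 ≤ p) : c (q * p - t) = 0 := by
  have hp : 2 ≤ p := (Fact.out : p.Prime).two_le
  have mulh : ∀ q t, q + 1 ≤ M → n ≤ t → q * p + p + n ≤ M * p + t := by
    intro q t h1 h2
    have := Nat.mul_le_mul_right p h1
    rw [add_mul, one_mul] at this
    omega
  have fwd : ∀ d, n + 1 + d + 1 ≤ p → ∀ q, d + 2 ≤ q → q ≤ M → c (q * p - (n + 1 + d)) = 0 := by
    intro d
    induction d with
    | zero =>
      intro h1 q h2 h3
      obtain ⟨Q, rfl⟩ : ∃ Q, q = Q + 1 := ⟨q - 1, by omega⟩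
      have := cz_one p M n c hc Q n (by omega) (by omega) (mulh _ _ h3 le_rfl)
      rw [sub_self, zero_mul] at this
      have hne := cz_nat_ne p (n + 1) (by omega) (by omega)
      push_cast at hne
      exact (mul_eq_zero.1 this).resolve_left hne
    | succ d ih =>
      intro h1 q h2 h3
      obtain ⟨Q, rfl⟩ : ∃ Q, q = Q + 1 := ⟨q - 1, by omega⟩
      have := cz_one p M n c hc Q (n + 1 + d) (by omega) (by omega) (mulh _ _ h3 (by omega))
      rw [ih (by omega) Q (by omega) (by omega), mul_zero] at this
      have hne := cz_nat_ne p (n + 1 + d + 1) (by omega) (by omega)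
      rw [Nat.cast_add_one] at hne
      exact (mul_eq_zero.1 this).resolve_left hne
  have bwd : ∀ d, n + 1 + d + 1 ≤ p → ∀ q, 1 ≤ q → q + d + 1 ≤ M →
      c (q * p - (p - 1 - d)) = 0 := by
    intro d
    induction d with
    | zero =>
      intro h1 q h2 h3
      have := cz_one p M n c hc q (p - 1) (by omega) (by omega) (mulh _ _ h3 (by omega))
      rw [← Nat.cast_add_one, show p - 1 + 1 = p by omega, CharP.cast_eq_zero, zero_mul] at this
      exact (mul_eq_zero.1 this.symm).resolve_left
        (cz_sub_ne p (p - 1) n (by omega) (by omega) (by omega))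
    | succ d ih =>
      intro h1 q h2 h3
      have := cz_one p M n c hc q (p - 1 - (d + 1)) (by omega) (by omega)
        (mulh _ _ (by omega) (by omega))
      rw [show p - 1 - (d + 1) + 1 = p - 1 - d by omega, ih (by omega) (q + 1) (by omega) (by omega),
        mul_zero] at this
      exact (mul_eq_zero.1 this.symm).resolve_left
        (cz_sub_ne p (p - 1 - (d + 1)) n (by omega) (by omega) (by omega))
  rcases Nat.lt_or_ge t (q + n) with h | h
  · have := fwd (t - n - 1) (by omega) q (by omega) hqM
    rwa [show n + 1 + (t - n - 1) = t by omega] at this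
  · have := bwd (p - 1 - t) (by omega) q hq (by omega)
    rwa [show p - 1 - (p - 1 - t) = t by omega] at this

/-- write `a ≥ 1` as `q p - t` -/
lemma cz_repr (p a : ℕ) (hp : 2 ≤ p) (ha : 1 ≤ a) :
    ∃ q t, 1 ≤ q ∧ t + 1 ≤ p ∧ a + t = q * p := by
  have h1 := Nat.div_add_mod (a - 1) p
  have h2 := Nat.mod_lt (a - 1) (show p > 0 by omega)
  refine ⟨(a - 1) / p + 1, p - 1 - (a - 1) % p, Nat.succ_pos _, by omega, ?_⟩
  rw [add_mul, one_mul, mul_comm]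
  omega

lemma cz_notdvd (p M : ℕ) [Fact p.Prime] (c : ℕ → ZMod p) (hc : czRel p (M * p) c)
    (hM : p ≤ M) (a : ℕ) (ha : 1 ≤ a) (haM : a < M * p) (hd : ¬ p ∣ a) : c a = 0 := by
  have hp : 2 ≤ p := (Fact.out : p.Prime).two_le
  obtain ⟨q, t, hq, ht, h⟩ := cz_repr p a hp ha
  have ht0 : t ≠ 0 := by rintro rfl; exact hd ⟨q, by rw [mul_comm, ← h, add_zero]⟩
  have hqM : q ≤ M := by
    by_contra hcon
    have := Nat.mul_le_mul_right p (show M + 1 ≤ q by omega)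
    rw [add_mul, one_mul] at this
    omega
  have := cz_van p M 0 c (by simpa using hc) (by omega) hM q t hq hqM (by omega) ht
  rwa [show q * p - t = a by omega] at this

lemma cz_down (p M : ℕ) [Fact p.Prime] (c : ℕ → ZMod p) (hc : czRel p (M * p) c)
    (hM : p ≤ M) : czRel p M (fun a => c (a * p)) := by
  have hp : 2 ≤ p := (Fact.out : p.Prime).two_le
  intro r e f hr hef
  have hN : e * p + (p - 1) + (f * p + (p - 1)) + 2 + r * p * (p - 1) = M * p := by
    rw [← hef]
    obtain ⟨P, rfl⟩ : ∃ P, p = P + 1 := ⟨p - 1, by omega⟩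
    simp only [Nat.add_sub_cancel]; ring
  have h := hc (r * p) (e * p + (p - 1)) (f * p + (p - 1)) (Nat.mul_pos hr (by omega)) hN
  rw [← h]
  apply Finset.sum_of_injOn (fun uv : ℕ × ℕ => (uv.1 * p, uv.2 * p))
  · rintro ⟨a, b⟩ _ ⟨a', b'⟩ _ hab
    simp only [Prod.mk.injEq] at hab
    ext
    · exact Nat.eq_of_mul_eq_mul_right (by omega) hab.1
    · exact Nat.eq_of_mul_eq_mul_right (by omega) hab.2
  · rintro ⟨a, b⟩ hab
    simp only [Finset.mem_coe, Finset.HasAntidiagonal.mem_antidiagonal] at hab ⊢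
    rw [← hab]; ring
  · rintro ⟨a, b⟩ hab hnot
    simp only [Finset.HasAntidiagonal.mem_antidiagonal] at hab
    have hpa : ¬ p ∣ a := by
      rintro ⟨x, rfl⟩
      have : p ∣ b := (Nat.dvd_add_right (Dvd.intro x rfl)).1 ⟨r, by rw [hab]; ring⟩
      obtain ⟨y, rfl⟩ := this
      apply hnot
      refine ⟨(x, y), ?_, ?_⟩
      · simp only [Finset.mem_coe, Finset.HasAntidiagonal.mem_antidiagonal]
        apply Nat.eq_of_mul_eq_mul_left (show 0 < p by omega)
        rw [mul_comm p r, ← hab]; ring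
      · ext <;> simp only <;> ring
    have hle : a * (p - 1) ≤ r * p * (p - 1) := Nat.mul_le_mul_right _ (by omega)
    simp only
    rw [cz_notdvd p M c hc hM (e * p + (p - 1) + 1 + a * (p - 1)) (by omega) (by omega), mul_zero]
    intro hd
    apply hpa
    have h2 : e * p + (p - 1) + 1 + a * (p - 1) + a = (e + 1 + a) * p := by
      obtain ⟨P, rfl⟩ : ∃ P, p = P + 1 := ⟨p - 1, by omega⟩
      simp only [Nat.add_sub_cancel]; ring
    exact (Nat.dvd_add_right hd).1 ⟨e + 1 + a, by rw [h2]; ring⟩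
  · rintro ⟨a, b⟩ _
    simp only
    have l1 := cz_lucas p e (p - 1) a 0 (by omega) (by omega)
    have l2 := cz_lucas p f (p - 1) b 0 (by omega) (by omega)
    simp only [add_zero, Nat.choose_zero_right, Nat.cast_one, one_mul] at l1 l2
    rw [l1, l2]
    congr 2
    obtain ⟨P, rfl⟩ : ∃ P, p = P + 1 := ⟨p - 1, by omega⟩
    simp only [Nat.add_sub_cancel]; ring

/-- The relation coming from `P^p`. -/
lemma cz_pp (p i j n : ℕ) [Fact p.Prime] (c : ℕ → ZMod p) (hn : n + 1 + j = p) (hj : 1 ≤ j)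
    (hc : czRel p ((p + i + 1) * p - n) c)
    (q t : ℕ) (hq : 1 ≤ q) (hqi : q ≤ i + 1) (ht : t ≤ n) :
    ((i + 1 - q : ℕ) : ZMod p) * c (q * p - t) +
      ((q - 1 : ℕ) : ZMod p) * c ((q + p - 1) * p - t) = 0 := by
  have hp : 2 ≤ p := (Fact.out : p.Prime).two_le
  obtain ⟨Q, rfl⟩ : ∃ Q, q = Q + 1 := ⟨q - 1, by omega⟩
  obtain ⟨F, rfl⟩ : ∃ F, i = Q + F := ⟨i - Q, by omega⟩
  obtain ⟨P, hP⟩ : ∃ P, p = P + 1 := ⟨p - 1, by omega⟩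
  have hE : Q * p + (P - t) + 1 + t = (Q + 1) * p := by rw [add_mul, one_mul]; omega
  have h := hc p (Q * p + (P - t)) (F * p + (j + t)) (by omega) (by
    have : (p + (Q + F) + 1) * p = p * p + Q * p + F * p + p := by ring
    have h2 : p * (p - 1) + p = p * p := by
      subst hP; simp only [Nat.add_sub_cancel]; ring
    omega)
  rw [Finset.Nat.sum_antidiagonal_eq_sum_range_succ_mk, Finset.sum_range_succ] at h
  have l1 := cz_lucas p Q (P - t) 1 0 (by omega) (by omega)
  have l2 := cz_lucas p F (j + t) 1 0 (by omega) (by omega)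
  simp only [add_zero, Nat.choose_zero_right, Nat.cast_one, one_mul, Nat.choose_one_right] at l1 l2
  have hmid : ∑ x ∈ Finset.range p, (((Q * p + (P - t)).choose x : ℕ) : ZMod p) *
      (((F * p + (j + t)).choose (p - x) : ℕ) : ZMod p) *
        c (Q * p + (P - t) + 1 + x * (p - 1)) = F * c (Q * p + (P - t) + 1) := by
    conv_lhs => rw [show Finset.range p = Finset.range (P + 1) by rw [hP]]
    rw [Finset.sum_range_succ', Finset.sum_eq_zero]
    · simp only [Nat.choose_zero_right, Nat.sub_zero, l2, Nat.cast_one, one_mul, zero_mul, add_zero,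
        zero_add]
    · intro x hx
      simp only [Finset.mem_range] at hx
      by_cases h1 : p ≤ t + (x + 1)
      · have := cz_lucas p Q (P - t) 0 (x + 1) (by omega) (by omega)
        rw [zero_mul, zero_add] at this
        rw [this, Nat.choose_eq_zero_of_lt (show P - t < x + 1 by omega)]
        simp
      · by_cases h2 : t + (x + 1) ≤ n
        · have := cz_lucas p F (j + t) 0 (p - (x + 1)) (by omega) (by omega)
          rw [zero_mul, zero_add] at this
          rw [this, Nat.choose_eq_zero_of_lt (show j + t < p - (x + 1) by omega)]
          simp
        · have := cz_van p (p + (Q + F) + 1) n c hc (by omega) (by omega) (Q + 1 + (x + 1))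
            (t + (x + 1)) (by omega) (by omega) (by omega) (by omega)
          have e : (Q + 1 + (x + 1)) * p - (t + (x + 1)) =
              Q * p + (P - t) + 1 + (x + 1) * (p - 1) := by
            have e1 : (Q + 1 + (x + 1)) * p = (Q + 1) * p + ((x + 1) * (p - 1) + (x + 1)) := by
              subst hP; simp only [Nat.add_sub_cancel]; ring
            omega
          rw [e] at this
          rw [this, mul_zero]
  simp only at h
  rw [hmid] at h
  rw [l1, Nat.sub_self, Nat.choose_zero_right, Nat.cast_one, mul_one] at h
  have e1 : (Q + 1) * p - t = Q * p + (P - t) + 1 := by omega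
  have e2 : (Q + 1 + p - 1) * p - t = Q * p + (P - t) + 1 + p * (p - 1) := by
    have : (Q + 1 + p - 1) * p = (Q + 1) * p + p * (p - 1) := by
      subst hP
      rw [show Q + 1 + (P + 1) - 1 = Q + 1 + P by omega]
      simp only [Nat.add_sub_cancel]; ring
    omega
  rw [e1, e2, show Q + F + 1 - (Q + 1) = F by omega, show Q + 1 - 1 = Q by omega]
  exact h

lemma cz_base0 (p i j n : ℕ) [Fact p.Prime] (c : ℕ → ZMod p) (hn : n + 1 + j = p)
    (hi : 1 ≤ i) (hij : i ≤ j) (hn1 : 1 ≤ n)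
    (hc : czRel p ((p + i + 1) * p - n) c)
    (hz : ∀ k, i ≤ k → k ≤ j → c ((k + 1) * p) = 0)
    (a : ℕ) (ha : 1 ≤ a) (haN : a < (p + i + 1) * p - n) : c a = 0 := by
  have hp : 2 ≤ p := (Fact.out : p.Prime).two_le
  -- diagonal moves
  have diag : ∀ q t, 1 ≤ q → q + 1 ≤ p + i → t < n →
      ((t : ZMod p) + 1) * c ((q + 1) * p - (t + 1)) = ((t : ZMod p) - n) * c (q * p - t) := by
    intro q t h1 h2 h3
    apply cz_one p (p + i + 1) n c hc q t h1 (by omega)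
    have := Nat.mul_le_mul_right p h2
    rw [add_mul q, one_mul] at this
    rw [add_mul (p + i), one_mul]
    omega
  have up1 : ∀ q t, 1 ≤ q → q + 1 ≤ p + i → t < n → c (q * p - t) = 0 →
      c ((q + 1) * p - (t + 1)) = 0 := by
    intro q t h1 h2 h3 h
    have := diag q t h1 h2 h3
    rw [h, mul_zero] at this
    have hne := cz_nat_ne p (t + 1) (by omega) (by omega)
    rw [Nat.cast_add_one] at hne
    exact (mul_eq_zero.1 this).resolve_left hne
  have down1 : ∀ q t, 1 ≤ q → q + 1 ≤ p + i → t < n → c ((q + 1) * p - (t + 1)) = 0 →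
      c (q * p - t) = 0 := by
    intro q t h1 h2 h3 h
    have := diag q t h1 h2 h3
    rw [h, mul_zero] at this
    exact (mul_eq_zero.1 this.symm).resolve_left (cz_sub_ne p t n (by omega) (by omega) (by omega))
  have up : ∀ d q t, 1 ≤ q → q + d ≤ p + i → t + d ≤ n → c (q * p - t) = 0 →
      c ((q + d) * p - (t + d)) = 0 := by
    intro d
    induction d with
    | zero => intro q t _ _ _ h; simpa using h
    | succ d ih =>
      intro q t h1 h2 h3 h
      exact up1 (q + d) (t + d) (by omega) (by omega) (by omega)
        (ih q t h1 (by omega) (by omega) h)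
  have down : ∀ d q t, 1 ≤ q → q + d ≤ p + i → t + d ≤ n → c ((q + d) * p - (t + d)) = 0 →
      c (q * p - t) = 0 := by
    intro d
    induction d with
    | zero => intro q t _ _ _ h; simpa using h
    | succ d ih =>
      intro q t h1 h2 h3 h
      exact ih q t h1 (by omega) (by omega)
        (down1 (q + d) (t + d) (by omega) (by omega) (by omega) h)
  have pp := cz_pp p i j n c hn (by omega) hc
  have hi0 := cz_nat_ne p i (by omega) (by omega)
  have F1 : ∀ q t, 1 ≤ q → q ≤ i → t < n → c (q * p - t) = 0 ∧ c ((q + p - 1) * p - t) = 0 := by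
    intro q t h1 h2 h3
    have r1 := pp q t h1 (by omega) (by omega)
    have r2 := pp (q + 1) (t + 1) (by omega) (by omega) (by omega)
    have d1 := diag q t h1 (by omega) h3
    have d2 := diag (q + p - 1) t (by omega) (by omega) h3
    rw [show q + p - 1 + 1 = q + 1 + p - 1 by omega] at d2
    have k1 : ((i + 1 - q : ℕ) : ZMod p) = (i : ZMod p) + 1 - q := by
      rw [Nat.cast_sub (by omega)]; push_cast; ring
    have k2 : ((q - 1 : ℕ) : ZMod p) = (q : ZMod p) - 1 := by
      rw [Nat.cast_sub (by omega)]; push_cast; ring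
    have k3 : ((i + 1 - (q + 1) : ℕ) : ZMod p) = (i : ZMod p) - q := by
      rw [show i + 1 - (q + 1) = i - q by omega, Nat.cast_sub (by omega)]
    rw [k1, k2] at r1
    rw [k3, show q + 1 - 1 = q by omega] at r2
    have hne := cz_sub_ne p t n (by omega) (by omega) (by omega)
    have r3 : ((i : ZMod p) - q) * c (q * p - t) + q * c ((q + p - 1) * p - t) = 0 := by
      apply mul_left_cancel₀ hne
      linear_combination ((t : ZMod p) + 1) * r2 - ((i : ZMod p) - q) * d1 - (q : ZMod p) * d2
    have r4 : c (q * p - t) = c ((q + p - 1) * p - t) := by linear_combination r1 - r3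
    have r5 : (i : ZMod p) * c (q * p - t) = 0 := by
      linear_combination r3 + (q : ZMod p) * r4
    have r6 := (mul_eq_zero.1 r5).resolve_left hi0
    exact ⟨r6, r4 ▸ r6⟩
  have F2 : ∀ t, t ≤ n → c (1 * p - t) = 0 := by
    intro t h
    have := pp 1 t le_rfl (by omega) h
    simp only [Nat.sub_self, Nat.cast_zero, zero_mul, add_zero, Nat.add_sub_cancel] at this
    exact (mul_eq_zero.1 this).resolve_left hi0
  have F3 : ∀ t, t ≤ n → c ((i + p) * p - t) = 0 := by
    intro t h
    have := pp (i + 1) t (by omega) le_rfl h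
    rw [Nat.sub_self, Nat.cast_zero, zero_mul, zero_add, show i + 1 - 1 = i by omega,
      show i + 1 + p - 1 = i + p by omega] at this
    exact (mul_eq_zero.1 this).resolve_left hi0
  have row0 : ∀ k, 1 ≤ k → k ≤ i + p → c (k * p - 0) = 0 := by
    intro k h1 h2
    by_cases a1 : k ≤ i
    · exact (F1 k 0 h1 a1 (by omega)).1
    by_cases a2 : k ≤ j + 1
    · have := hz (k - 1) (by omega) (by omega)
      rwa [show k - 1 + 1 = k by omega] at this
    by_cases a3 : k < p
    · apply down (p - k) k 0 h1 (by omega) (by omega)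
      rw [show k + (p - k) = 1 + p - 1 by omega]
      exact (F1 1 (0 + (p - k)) le_rfl hi (by omega)).2
    by_cases a4 : k < i + p
    · have := (F1 (k + 1 - p) 0 (by omega) (by omega) (by omega)).2
      rwa [show k + 1 - p + p - 1 = k by omega] at this
    · rw [show k = i + p by omega]; exact F3 0 (by omega)
  obtain ⟨q, t, hq, ht, h⟩ := cz_repr p a hp ha
  have haq : a = q * p - t := by omega
  have hNe : (p + i + 1) * p = (p + i) * p + p := by ring
  by_cases htn : t ≤ n
  · have hqM : q ≤ p + i := by
      by_contra hcon
      have := Nat.mul_le_mul_right p (show p + i + 1 ≤ q by omega)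
      omega
    rw [haq]
    by_cases hqt : q ≤ t
    · have := up (q - 1) 1 (t + 1 - q) le_rfl (by omega) (by omega) (F2 _ (by omega))
      rwa [show 1 + (q - 1) = q by omega, show t + 1 - q + (q - 1) = t by omega] at this
    · have := up t (q - t) 0 (by omega) (by omega) (by omega) (row0 _ (by omega) (by omega))
      rwa [show q - t + t = q by omega, zero_add] at this
  · have hqM : q ≤ p + i + 1 := by
      by_contra hcon
      have := Nat.mul_le_mul_right p (show p + i + 1 + 1 ≤ q by omega)
      rw [add_mul (p + i + 1), one_mul] at this
      omega
    rw [haq]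
    exact cz_van p (p + i + 1) n c hc (by omega) (by omega) q t hq hqM (by omega) ht

lemma cz_all (p i j : ℕ) [Fact p.Prime] (hi : 1 ≤ i) (hij : i ≤ j) (hj : j + 2 ≤ p) (s : ℕ) :
    ∀ c : ℕ → ZMod p, czRel p ((p ^ 2 + i * p + j + 1) * p ^ s) c →
      (∀ k, i ≤ k → k ≤ j → c ((k + 1) * p ^ (s + 1)) = 0) →
      ∀ a, 1 ≤ a → a < (p ^ 2 + i * p + j + 1) * p ^ s → c a = 0 := by
  have hp : 2 ≤ p := (Fact.out : p.Prime).two_le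
  induction s with
  | zero =>
    intro c hc hz a ha haN
    obtain ⟨n, hn⟩ : ∃ n, n + 1 + j = p := ⟨p - 1 - j, by omega⟩
    have hN : (p ^ 2 + i * p + j + 1) * p ^ 0 = (p + i + 1) * p - n := by
      have : (p + i + 1) * p = p ^ 2 + i * p + p := by ring
      rw [this, pow_zero, mul_one]; omega
    rw [hN] at hc haN
    exact cz_base0 p i j n c hn hi hij (by omega) hc (by simpa using hz) a ha haN
  | succ s ih =>
    intro c hc hz a ha haN
    rw [pow_succ p s, ← mul_assoc] at hc haN
    set M := (p ^ 2 + i * p + j + 1) * p ^ s with hMdef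
    have hM : p ≤ M := by
      have h1 : 1 ≤ p ^ s := Nat.one_le_pow _ _ (by omega)
      have h2 := Nat.mul_le_mul_left (p ^ 2 + i * p + j + 1) h1
      have h3 : p ≤ i * p := Nat.le_mul_of_pos_left p hi
      omega
    by_cases hd : p ∣ a
    · obtain ⟨b, rfl⟩ := hd
      have := ih (fun a => c (a * p)) (cz_down p M c hc hM) (by
        intro k h1 h2
        have := hz k h1 h2
        rw [pow_succ p (s + 1), ← mul_assoc] at this
        exact this) b (by
          rcases Nat.eq_zero_or_pos b with h | h
          · subst h; simp at ha
          · exact h) (by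
          rw [mul_comm M] at haN
          exact Nat.lt_of_mul_lt_mul_left haN)
      rw [mul_comm]; exact this
    · exact cz_notdvd p M c hc hM a ha haN hd

lemma cz_arith (p i j k s m : ℕ) (hp : 2 ≤ p) (hik : i ≤ k) (hkj : k ≤ j) (hj : j + 2 ≤ p)
    (hm : m + 2 = (p ^ 2 + i * p + j + 1) * p ^ s) :
    1 ≤ (k + 1) * p ^ (s + 1) ∧ (k + 1) * p ^ (s + 1) ≤ m + 1 ∧
    (k + 1) * p ^ (s + 1) = p ^ s * ((k + 1) * p) ∧
    m - ((k + 1) * p ^ (s + 1) - 1) + 1 =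
      p ^ s * ((i + j + 1 - k) * p + (p - 1) * (p - 1 - j)) := by
  have hA : (k + 1) * p ^ (s + 1) = p ^ s * ((k + 1) * p) := by rw [pow_succ]; ring
  have hA1 : 1 ≤ (k + 1) * p ^ (s + 1) := Nat.mul_pos (by omega) (by positivity)
  have hsum : (k + 1) * p ^ (s + 1) + p ^ s * ((i + j + 1 - k) * p + (p - 1) * (p - 1 - j)) =
      m + 2 := by
    rw [hA, hm]
    obtain ⟨n, rfl⟩ : ∃ n, p = n + 1 + j := ⟨p - 1 - j, by omega⟩
    obtain ⟨d, rfl⟩ : ∃ d, j = k + d := ⟨j - k, by omega⟩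
    rw [show i + (k + d) + 1 - k = i + d + 1 by omega,
      show n + 1 + (k + d) - 1 - (k + d) = n by omega,
      show n + 1 + (k + d) - 1 = n + (k + d) by omega]
    ring
  have hB1 : 1 ≤ p ^ s * ((i + j + 1 - k) * p + (p - 1) * (p - 1 - j)) := by
    apply Nat.mul_pos (by positivity)
    have : 0 < (i + j + 1 - k) * p := Nat.mul_pos (by omega) (by omega)
    omega
  refine ⟨hA1, ?_, hA, ?_⟩ <;> omega

lemma czLam_val (p i j k k' s m : ℕ) [Fact p.Prime] (hk : i ≤ k ∧ k ≤ j) (hk' : i ≤ k' ∧ k' ≤ j)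
    (hj : j + 2 ≤ p) (hm : m + 2 = (p ^ 2 + i * p + j + 1) * p ^ s) :
    czLam p s (k + 1) (i + j + 1 - k) (p - 1 - j)
      (X 0 ^ ((k' + 1) * p ^ (s + 1) - 1) * X 1 ^ (m - ((k' + 1) * p ^ (s + 1) - 1))) =
      if k = k' then 1 else 0 := by
  have hp : 2 ≤ p := (Fact.out : p.Prime).two_le
  rw [czLam_apply _ _ _ _ _ (by omega) (by omega)]
  obtain ⟨a1, a2, a3, a4⟩ := cz_arith p i j k' s m hp hk'.1 hk'.2 hj hm
  have key : ∀ t, t < p - 1 - j + 1 → (k' + 1) * p ^ (s + 1) - 1 + 1 =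
      p ^ s * ((k + 1) * p + (p - 1) * t) → t = 0 ∧ k = k' := by
    intro t ht h
    rw [Nat.sub_add_cancel a1, a3] at h
    have h2 := Nat.eq_of_mul_eq_mul_left (show 0 < p ^ s by positivity) h
    have h3 : (k' + 1) * p + t = (k + 1 + t) * p := by
      rw [h2]
      obtain ⟨P, rfl⟩ : ∃ P, p = P + 1 := ⟨p - 1, by omega⟩
      simp only [Nat.add_sub_cancel]; ring
    have h4 : p ∣ t := by
      have : p ∣ (k' + 1) * p + t := by rw [h3]; exact Dvd.intro_left _ rfl
      exact (Nat.dvd_add_right (Dvd.intro_left _ rfl)).1 this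
    have h5 : t = 0 := by
      by_contra h0
      have := Nat.le_of_dvd (by omega) h4
      omega
    subst h5
    have := Nat.eq_of_mul_eq_mul_right (show 0 < p by omega) h3
    exact ⟨rfl, by omega⟩
  rw [Finset.sum_eq_single 0]
  · by_cases hkk : k = k'
    · subst hkk
      rw [if_pos, if_pos rfl]
      · simp
      · refine ⟨?_, ?_⟩
        · rw [Nat.sub_add_cancel a1, a3, mul_zero, add_zero]
        · rw [a4, Nat.sub_zero]
    · rw [if_neg, if_neg hkk, mul_zero]
      rintro ⟨h, -⟩
      exact hkk (key 0 (by omega) h).2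
  · intro t ht ht0
    rw [if_neg, mul_zero]
    rintro ⟨h, -⟩
    exact ht0 (key t (by simpa using ht) h).1
  · intro h; simp at h

lemma cz_span (p i j s m : ℕ) [Fact p.Prime] (hi : 1 ≤ i) (hij : i ≤ j) (hj : j + 2 ≤ p)
    (hm : m + 2 = (p ^ 2 + i * p + j + 1) * p ^ s)
    (f : MvPolynomial (Fin 2) (ZMod p)) (hf : f.IsHomogeneous m) :
    f ∈ Hit p 2 ⊔ Submodule.span (ZMod p) (basisSet11 p i j s m) := by
  have hp : 2 ≤ p := (Fact.out : p.Prime).two_le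
  by_contra hcon
  obtain ⟨lam, hne, hle⟩ := Submodule.exists_le_ker_of_notMem hcon
  apply hne
  have hH : ∀ x ∈ Hit p 2, lam x = 0 := fun x hx => hle (Submodule.mem_sup_left hx)
  have hB : ∀ x ∈ basisSet11 p i j s m, lam x = 0 := fun x hx =>
    hle (Submodule.mem_sup_right (Submodule.subset_span hx))
  have hall := cz_all p i j hi hij hj s (fun a => lam (X 0 ^ (a - 1) * X 1 ^ (m - (a - 1)))) (by
      intro r e g hr heg
      have h1 := hH (steenrodP p 2 r (X 0 ^ e * X 1 ^ g))
        (Submodule.subset_span ⟨r, hr, _, rfl⟩)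
      rw [cz_mono, map_sum] at h1
      rw [← h1]
      apply Finset.sum_congr rfl
      rintro ⟨u, v⟩ huv
      rw [Finset.HasAntidiagonal.mem_antidiagonal] at huv
      simp only at huv
      simp only [map_smul, smul_eq_mul]
      have e1 : e + 1 + u * (p - 1) - 1 = e + u * (p - 1) := by omega
      have e2 : m - (e + u * (p - 1)) = g + v * (p - 1) := by
        have : r * (p - 1) = u * (p - 1) + v * (p - 1) := by rw [← huv]; ring
        omega
      rw [e1, e2])
    (by
      intro k h1 h2
      exact hB _ ⟨k, h1, h2, rfl⟩)
  rw [cz_asum p f, map_sum]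
  apply Finset.sum_eq_zero
  intro d hd
  have hdeg : d 0 + d 1 = m := by
    have := hf (mem_support_iff.1 hd)
    rw [← this, Finsupp.weight_apply, Finsupp.sum_fintype _ _ (by simp)]
    simp
  have := hall (d 0 + 1) (by omega) (by omega)
  simp only [Nat.add_sub_cancel] at this
  rw [map_smul, show d 1 = m - d 0 by omega, this, smul_zero]

/-- Crossley's Theorem 1.1, fourth case: for `m = (p² + ip + j + 1)p^s - 2` with
`1 ≤ i ≤ j ≤ p-2`, `s ≥ 0`, the monomials `x^{(k+1)p^{s+1}-1} y^{m-(k+1)p^{s+1}+1}`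
(`i ≤ k ≤ j`) lie in the degree-`m` homogeneous part `V_m` and their images form a basis
of `V_m/(V_m ∩ H)`: the images mod the hit polynomials `H` are linearly independent, and
every homogeneous polynomial of degree `m` lies in `H ⊔ span(basisSet11)`. -/
theorem crossley_case4 (p : ℕ) (hp : p.Prime) (hodd : Odd p) (i j s m : ℕ)
    (hi : 1 ≤ i) (hij : i ≤ j) (hj : j ≤ p - 2)
    (hm : m = (p ^ 2 + i * p + j + 1) * p ^ s - 2) :
    (∀ g ∈ basisSet11 p i j s m, g.IsHomogeneous m) ∧
    LinearIndependent (ZMod p)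
      (fun g : basisSet11 p i j s m =>
        Submodule.Quotient.mk (p := Hit p 2) (g : MvPolynomial (Fin 2) (ZMod p))) ∧
    (∀ f : MvPolynomial (Fin 2) (ZMod p), f.IsHomogeneous m →
        f ∈ Hit p 2 ⊔ Submodule.span (ZMod p) (basisSet11 p i j s m)) := by
  have : Fact p.Prime := ⟨hp⟩
  have hp2 : 2 ≤ p := hp.two_le
  have hj' : j + 2 ≤ p := by omega
  have hm' : m + 2 = (p ^ 2 + i * p + j + 1) * p ^ s := by
    have h1 : 1 ≤ p ^ s := Nat.one_le_pow _ _ (by omega)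
    have h2 := Nat.mul_le_mul_left (p ^ 2 + i * p + j + 1) h1
    omega
  refine ⟨?_, ?_, fun f hf => cz_span p i j s m hi hij hj' hm' f hf⟩
  · rintro _ ⟨k, h1, h2, rfl⟩
    obtain ⟨a1, a2, -, -⟩ := cz_arith p i j k s m hp2 h1 h2 hj' hm'
    have := (isHomogeneous_X_pow (R := ZMod p) (0 : Fin 2) ((k + 1) * p ^ (s + 1) - 1)).mul
      (isHomogeneous_X_pow (R := ZMod p) (1 : Fin 2) (m - ((k + 1) * p ^ (s + 1) - 1)))
    rwa [show (k + 1) * p ^ (s + 1) - 1 + (m - ((k + 1) * p ^ (s + 1) - 1)) = m by omega] at this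
  · have hex : ∀ g : basisSet11 p i j s m, ∃ k, i ≤ k ∧ k ≤ j ∧
      (g : MvPolynomial (Fin 2) (ZMod p)) =
        X 0 ^ ((k + 1) * p ^ (s + 1) - 1) * X 1 ^ (m - ((k + 1) * p ^ (s + 1) - 1)) :=
      fun g => g.2
    choose k hk1 hk2 hk3 using hex
    have hker : ∀ g, Hit p 2 ≤ LinearMap.ker
        (czLam p s (k g + 1) (i + j + 1 - k g) (p - 1 - j)) := by
      intro g
      have := hk1 g
      have := hk2 g
      exact czLam_hit p s _ _ _ (by omega) (by omega) (by omega) (by omega) (by omega)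
    have hval : ∀ g g' : basisSet11 p i j s m, czLam p s (k g + 1) (i + j + 1 - k g) (p - 1 - j)
        (g' : MvPolynomial (Fin 2) (ZMod p)) = if k g = k g' then 1 else 0 := by
      intro g g'
      rw [hk3 g']
      exact czLam_val p i j (k g) (k g') s m ⟨hk1 g, hk2 g⟩ ⟨hk1 g', hk2 g'⟩ hj' hm'
    apply LinearIndependent.of_pairwise_dual_eq_zero_one _
      (fun g => (Hit p 2).liftQ (czLam p s (k g + 1) (i + j + 1 - k g) (p - 1 - j)) (hker g))
    · intro g g' hgg
      simp only [Submodule.liftQ_apply]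
      rw [hval, if_neg]
      intro h
      apply hgg
      apply Subtype.ext
      rw [hk3 g, hk3 g', h]
    · intro g
      simp only [Submodule.liftQ_apply]
      rw [hval, if_pos rfl]
end
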